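/- arXiv:2504.18476 — 12 statements merged into one kernel-verified Lean document; each statement's English description precedes it below -/
import Mathlib

section
/- Let Q be a finite simple graph and P ⊆ V(Q). Let Q̄ be the auxiliary bipartite graph on X̄ ∪ Ȳ associated with (Q, P), let M be a maximum matching of Q̄, and let Q̄_M be the associated directed graph. If S̄ is a tail strongly connected component of Q̄_M with S_X ≠ ∅ and S_X ∩ S_Y = ∅, then (S_X, S_Y) is a crown in Q with S_X ⊆ P. -/
/-- A crown `(I, H)` in a graph `G`: `I` is a nonempty independent set, `H = N_G(I)`,
and there is a matching between `H` and `I` saturating `H`. -/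
def IsCrown {V : Type*} (G : SimpleGraph V) (I H : Set V) : Prop :=
  I.Nonempty ∧
  (∀ u ∈ I, ∀ v ∈ I, ¬ G.Adj u v) ∧
  H = {v | ∃ u ∈ I, G.Adj u v} ∧
  ∃ f : V → V, Set.InjOn f H ∧ ∀ v ∈ H, f v ∈ I ∧ G.Adj v (f v)

/-- A matching of the auxiliary bipartite graph `Q̄` associated with `(Q, P)`:
a set of pairs `(u, v)` (representing edges `{x_u, y_v}`) with `u ∈ P` and
`{u, v} ∈ E(Q)`, no two sharing a first or a second coordinate. -/
def IsBipMatching {V : Type*} (Q : SimpleGraph V) (P : Finset V) (M : Finset (V × V)) : Prop :=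
  (∀ p ∈ M, p.1 ∈ P ∧ Q.Adj p.1 p.2) ∧
  (∀ p ∈ M, ∀ q ∈ M, p.1 = q.1 → p = q) ∧
  (∀ p ∈ M, ∀ q ∈ M, p.2 = q.2 → p = q)

/-- The arc relation of the directed graph `Q̄_M` on `X̄ ∪ Ȳ` (encoded as `V ⊕ V`,
where `Sum.inl u = x_u` and `Sum.inr v = y_v`): every edge `{x_u, y_v}` of `Q̄` is
directed from `x_u` to `y_v`, and additionally from `y_v` to `x_u` if it is in `M`. -/
def auxArc {V : Type*} (Q : SimpleGraph V) (P : Finset V) (M : Finset (V × V)) :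
    V ⊕ V → V ⊕ V → Prop
  | Sum.inl u, Sum.inr v => u ∈ P ∧ Q.Adj u v
  | Sum.inr v, Sum.inl u => (u, v) ∈ M
  | _, _ => False

/-- A tail strongly connected component of the relation `A`: a nonempty set with no
arcs leaving it, in which any two vertices are joined by directed paths (inside the
set) in both directions. -/
def IsTailSCC {α : Type*} (A : α → α → Prop) (S : Set α) : Prop :=
  S.Nonempty ∧
  (∀ a ∈ S, ∀ b, A a b → b ∈ S) ∧
  (∀ a ∈ S, ∀ b ∈ S, Relation.ReflTransGen (fun x y => x ∈ S ∧ y ∈ S ∧ A x y) a b)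

/-- In a tail strongly connected component that meets `X̄`, every `y_v` is matched to some `x_w`
of the component. -/
theorem IsTailSCC.exists_matched {V : Type*} {Q : SimpleGraph V} {P : Finset V}
    {M : Finset (V × V)} {S : Set (V ⊕ V)} (hS : IsTailSCC (auxArc Q P M) S) {u v : V}
    (hu : Sum.inl u ∈ S) (hv : Sum.inr v ∈ S) : ∃ w, Sum.inl w ∈ S ∧ (w, v) ∈ M := by
  rcases (hS.2.2 _ hv _ hu).cases_head with h | ⟨c, ⟨-, hc, hA⟩, -⟩
  · cases h
  · cases c with
    | inl w => exact ⟨w, hc, hA⟩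
    | inr w => exact hA.elim

/-- If `S̄` is a tail strongly connected component of `Q̄_M` (for a maximum matching `M`
of the auxiliary bipartite graph of `(Q, P)`) with `S_X ≠ ∅` and `S_X ∩ S_Y = ∅`, then
`(S_X, S_Y)` is a crown in `Q` with `S_X ⊆ P`. -/
theorem stmt3 {V : Type*} [Fintype V] [DecidableEq V]
    (Q : SimpleGraph V) (P : Finset V) (M : Finset (V × V))
    (hM : IsBipMatching Q P M)
    (hMmax : ∀ M' : Finset (V × V), IsBipMatching Q P M' → M'.card ≤ M.card)
    (S : Set (V ⊕ V)) (hS : IsTailSCC (auxArc Q P M) S)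
    (hSX : {v : V | v ∈ P ∧ Sum.inl v ∈ S}.Nonempty)
    (hdisj : {v : V | v ∈ P ∧ Sum.inl v ∈ S} ∩ {v : V | Sum.inr v ∈ S} = ∅) :
    IsCrown Q {v : V | v ∈ P ∧ Sum.inl v ∈ S} {v : V | Sum.inr v ∈ S} ∧
      {v : V | v ∈ P ∧ Sum.inl v ∈ S} ⊆ ↑P := by
  have ⟨u₀, _, hu₀⟩ := hSX
  have hnbr : ∀ u ∈ P, Sum.inl u ∈ S → ∀ v, Q.Adj u v → Sum.inr v ∈ S :=
    fun u huP hu v huv => hS.2.1 _ hu (Sum.inr v) ⟨huP, huv⟩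
  have hmatch : ∀ v, ∃ w, Sum.inr v ∈ S → Sum.inl w ∈ S ∧ (w, v) ∈ M := by
    intro v
    by_cases hv : Sum.inr v ∈ S
    · obtain ⟨w, hw⟩ := hS.exists_matched hu₀ hv
      exact ⟨w, fun _ => hw⟩
    · exact ⟨v, fun h => absurd h hv⟩
  choose f hf using hmatch
  refine ⟨⟨hSX, ?_, ?_, f, ?_, ?_⟩, fun v hv => hv.1⟩
  · intro u hu v hv huv
    exact Set.notMem_empty v (hdisj ▸ ⟨hv, hnbr u hu.1 hu.2 v huv⟩)
  · ext v
    constructor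
    · intro hv
      have h := hM.1 _ (hf v hv).2
      exact ⟨f v, ⟨h.1, (hf v hv).1⟩, h.2⟩
    · rintro ⟨u, hu, huv⟩
      exact hnbr u hu.1 hu.2 v huv
  · intro v hv w hw hvw
    exact congrArg Prod.snd (hM.2.1 _ (hf v hv).2 _ (hf w hw).2 hvw)
  · intro v hv
    have h := hM.1 _ (hf v hv).2
    exact ⟨⟨h.1, (hf v hv).1⟩, h.2.symm⟩
end

section
/- Let Q be a finite simple graph and P ⊆ V(Q) such that no vertex of P is isolated in Q. Let Q̄ be the auxiliary bipartite graph on X̄ ∪ Ȳ associated with (Q, P), let M be a maximum matching of Q̄, and let Q̄_M be the associated directed graph. If Q contains a crown (I, H) with I ⊆ P, then Q̄_M has a tail strongly connected component S̄ with S_X ≠ ∅, S_Y ≠ ∅, and S_X ∩ S_Y = ∅. -/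
/-- An injection between finite sets into a set that is not larger is surjective. -/
theorem Set.MapsTo.surjOn_of_injOn_of_ncard_le {α β : Type*} [Finite β] {s : Set α} {t : Set β}
    {g : α → β} (hg : Set.MapsTo g s t) (hinj : Set.InjOn g s) (h : t.ncard ≤ s.ncard) :
    Set.SurjOn g s t := fun b hb =>
  let ⟨a, ha, hab⟩ := Set.surj_on_of_inj_on_of_ncard_le (fun a _ => g a) (fun _ ha => hg ha)
    (fun _ _ ha hb h => hinj ha hb h) h t.toFinite b hb
  ⟨a, ha, hab.symm⟩

/-- `AltReach Q M a n u`: the vertex `x_u` is reached from `x_a` by an alternating walk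
that uses `n` matching edges. -/
def AltReach {V : Type*} (Q : SimpleGraph V) (M : Finset (V × V)) (a : V) : ℕ → V → Prop
  | 0, u => u = a
  | n + 1, w => ∃ u y, AltReach Q M a n u ∧ Q.Adj u y ∧ (w, y) ∈ M

/-- Every nonempty set closed under a relation on a finite type contains a tail strongly
connected component. -/
theorem exists_isTailSCC_subset {α : Type*} [Finite α] (A : α → α → Prop) (T : Set α)
    (hne : T.Nonempty) (hT : ∀ a ∈ T, ∀ b, A a b → b ∈ T) :
    ∃ S ⊆ T, IsTailSCC A S := by
  obtain ⟨S, ⟨hST, hS, hcl⟩, hmin⟩ := (wellFounded_lt (α := Set α)).has_min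
    {S | S ⊆ T ∧ S.Nonempty ∧ ∀ a ∈ S, ∀ b, A a b → b ∈ S} ⟨T, subset_rfl, hne, hT⟩
  refine ⟨S, hST, hS, hcl, fun a ha b hb => ?_⟩
  set B : α → α → Prop := fun x y => x ∈ S ∧ y ∈ S ∧ A x y
  have hsub : {c | c ∈ S ∧ Relation.ReflTransGen B a c} ⊆ S := fun c hc => hc.1
  have heq : {c | c ∈ S ∧ Relation.ReflTransGen B a c} = S := by
    by_contra hn
    refine hmin _ ⟨hsub.trans hST, ⟨a, ha, .refl⟩, ?_⟩ (lt_of_le_of_ne hsub hn)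
    rintro c ⟨hc, hac⟩ d hcd
    have hd := hcl c hc d hcd
    exact ⟨hd, hac.tail ⟨hc, hd, hcd⟩⟩
  rw [← heq] at hb
  exact hb.2

/-- Disjoint sets `J ⊆ P` and `K` for which `x_J ∪ y_K` is closed under arcs and `y_K` is
matched contain a tail strongly connected component as desired. -/
theorem exists_isTailSCC_of_closed {V : Type*} [Finite V] (Q : SimpleGraph V) (P : Finset V)
    (hIso : ∀ v ∈ P, ∃ u, Q.Adj v u) (M : Finset (V × V)) (J K : Set V) (hJ : J.Nonempty)
    (hJP : J ⊆ ↑P) (hJK : Disjoint J K) (hadj : ∀ u ∈ J, ∀ v, Q.Adj u v → v ∈ K)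
    (hmat : ∀ v ∈ K, ∃ u, (u, v) ∈ M) (hback : ∀ v ∈ K, ∀ u, (u, v) ∈ M → u ∈ J) :
    ∃ S : Set (V ⊕ V), IsTailSCC (auxArc Q P M) S ∧
      {v : V | v ∈ P ∧ Sum.inl v ∈ S}.Nonempty ∧
      {v : V | Sum.inr v ∈ S}.Nonempty ∧
      {v : V | v ∈ P ∧ Sum.inl v ∈ S} ∩ {v : V | Sum.inr v ∈ S} = ∅ := by
  obtain ⟨j, hj⟩ := hJ
  obtain ⟨S, hST, hS⟩ := exists_isTailSCC_subset (auxArc Q P M) {z | Sum.elim (· ∈ J) (· ∈ K) z}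
    ⟨Sum.inl j, hj⟩ (by
      rintro (u | u) hu (v | v) huv
      · exact huv.elim
      · exact hadj u hu v huv.2
      · exact hback u hu v huv
      · exact huv.elim)
  have hl : ∀ u, Sum.inl u ∈ S → u ∈ J := fun u hu => hST hu
  have hr : ∀ u, Sum.inr u ∈ S → u ∈ K := fun u hu => hST hu
  have hlr : ∀ u, Sum.inl u ∈ S → ∃ v, Sum.inr v ∈ S := fun u hu =>
    have hP := hJP (hl u hu)
    (hIso u hP).imp fun v hv => hS.2.1 _ hu _ ⟨hP, hv⟩
  have hrl : ∀ v, Sum.inr v ∈ S → ∃ u, Sum.inl u ∈ S := fun v hv =>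
    (hmat v (hr v hv)).imp fun u hu => hS.2.1 _ hv (Sum.inl u) hu
  have hex : ∃ u, Sum.inl u ∈ S := by
    obtain ⟨u | v, h⟩ := hS.1
    · exact ⟨u, h⟩
    · exact hrl v h
  obtain ⟨u, hu⟩ := hex
  refine ⟨S, hS, ⟨u, hJP (hl u hu), hu⟩, hlr u hu, ?_⟩
  ext v
  simp only [Set.mem_inter_iff, Set.mem_ofPred_eq, Set.mem_empty_iff_false, iff_false]
  rintro ⟨⟨-, h1⟩, h2⟩
  exact Set.disjoint_left.mp hJK (hl v h1) (hr v h2)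

theorem IsBipMatching.insert {V : Type*} [DecidableEq V] {Q : SimpleGraph V} {P : Finset V}
    {M : Finset (V × V)} (hM : IsBipMatching Q P M) {u y : V} (huP : u ∈ P) (huy : Q.Adj u y)
    (hu : ∀ v, (u, v) ∉ M) (hy : ∀ v, (v, y) ∉ M) : IsBipMatching Q P (insert (u, y) M) := by
  obtain ⟨h1, h2, h3⟩ := hM
  refine ⟨?_, ?_, ?_⟩
  · simp only [Finset.mem_insert]
    rintro p (rfl | hp)
    exacts [⟨huP, huy⟩, h1 p hp]
  · simp only [Finset.mem_insert]
    rintro ⟨p, p'⟩ (hp | hp) ⟨q, q'⟩ (hq | hq) h <;> grind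
  · simp only [Finset.mem_insert]
    rintro ⟨p, p'⟩ (hp | hp) ⟨q, q'⟩ (hq | hq) h <;> grind

theorem IsBipMatching.mono {V : Type*} {Q : SimpleGraph V} {P : Finset V}
    {M N : Finset (V × V)} (hM : IsBipMatching Q P M) (hN : N ⊆ M) : IsBipMatching Q P N :=
  ⟨fun p hp => hM.1 p (hN hp), fun p hp q hq => hM.2.1 p (hN hp) q (hN hq),
    fun p hp q hq => hM.2.2 p (hN hp) q (hN hq)⟩

/-- Replacing the matching edge at `x_u` preserves alternating walks that avoid `x_u`. -/
theorem AltReach.exchange {V : Type*} [DecidableEq V] {Q : SimpleGraph V} {M : Finset (V × V)}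
    {a u y y' : V} : ∀ {n : ℕ} {v : V}, AltReach Q M a n v →
      AltReach Q (insert (u, y) (M.erase (u, y'))) a n v ∨ ∃ j ≤ n, AltReach Q M a j u
  | 0, _, h => .inl h
  | n + 1, v, h => by
    obtain ⟨w, z, hw, hwz, hvz⟩ := id h
    by_cases hvu : v = u
    · exact .inr ⟨n + 1, le_rfl, hvu ▸ h⟩
    rcases hw.exchange with h' | ⟨j, hj, h'⟩
    · exact .inl ⟨w, z, h', hwz, by simp [hvz, hvu]⟩
    · exact .inr ⟨j, by omega, h'⟩

/-- A maximum matching has no augmenting path. -/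
theorem exists_mem_of_altReach {V : Type*} [DecidableEq V] (Q : SimpleGraph V) (P : Finset V)
    (a : V) (haP : a ∈ P) (n : ℕ) : ∀ M : Finset (V × V), IsBipMatching Q P M →
      (∀ M' : Finset (V × V), IsBipMatching Q P M' → M'.card ≤ M.card) →
      (∀ v, (a, v) ∉ M) → ∀ u y, AltReach Q M a n u → Q.Adj u y → ∃ w, (w, y) ∈ M := by
  induction n using Nat.strong_induction_on with
  | _ n ih =>
  intro M hM hmax ha u y hu huy
  by_contra! hy
  cases n with
  | zero =>
    obtain rfl : u = a := hu
    have := hmax _ (hM.insert haP huy ha hy)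
    rw [Finset.card_insert_of_notMem (ha y)] at this
    omega
  | succ n =>
    obtain ⟨v, y', hv, hvy', huy'⟩ := hu
    have hua : u ≠ a := by rintro rfl; exact ha _ huy'
    have hyy' : y' ≠ y := by rintro rfl; exact hy _ huy'
    rcases hv.exchange (u := u) (y := y) (y' := y') with h | ⟨j, hj, h⟩
    · have hu' : ∀ z, (u, z) ∉ M.erase (u, y') := fun z hz => by
        rw [Finset.mem_erase] at hz
        exact hz.1 (hM.2.1 _ hz.2 _ huy' rfl)
      have hM' := (hM.mono (Finset.erase_subset (u, y') M)).insert (hM.1 _ huy').1 huy hu'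
        fun z hz => hy z (Finset.mem_of_mem_erase hz)
      have hcard : (insert (u, y) (M.erase (u, y'))).card = M.card := by
        rw [Finset.card_insert_of_notMem (hu' y), Finset.card_erase_add_one huy']
      obtain ⟨w, hw⟩ := ih n (by omega) _ hM' (by rwa [hcard]) (by simp [hua.symm, ha]) v y' h hvy'
      simp only [Finset.mem_insert, Finset.mem_erase, Prod.mk.injEq] at hw
      rcases hw with hw | hw
      · exact hyy' hw.2
      · exact hw.1 (hM.2.2 _ hw.2 _ huy' rfl)
    · obtain ⟨w, hw⟩ := ih j (by omega) M hM hmax ha u y h huy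
      exact hy w hw

/-- If no vertex of `P` is isolated in `Q`, `M` is a maximum matching of the auxiliary
bipartite graph of `(Q, P)`, and `Q` contains a crown `(I, H)` with `I ⊆ P`, then
`Q̄_M` has a tail strongly connected component `S̄` with `S_X ≠ ∅`, `S_Y ≠ ∅` and
`S_X ∩ S_Y = ∅`. -/
theorem stmt4 {V : Type*} [Fintype V] [DecidableEq V]
    (Q : SimpleGraph V) (P : Finset V)
    (hIso : ∀ v ∈ P, ∃ u, Q.Adj v u)
    (M : Finset (V × V))
    (hM : IsBipMatching Q P M)
    (hMmax : ∀ M' : Finset (V × V), IsBipMatching Q P M' → M'.card ≤ M.card)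
    (I H : Set V) (hcrown : IsCrown Q I H) (hIP : I ⊆ ↑P) :
    ∃ S : Set (V ⊕ V), IsTailSCC (auxArc Q P M) S ∧
      {v : V | v ∈ P ∧ Sum.inl v ∈ S}.Nonempty ∧
      {v : V | Sum.inr v ∈ S}.Nonempty ∧
      {v : V | v ∈ P ∧ Sum.inl v ∈ S} ∩ {v : V | Sum.inr v ∈ S} = ∅ := by
  obtain ⟨hI, hind, rfl, f, hf, hfI⟩ := hcrown
  set H := {v | ∃ u ∈ I, Q.Adj u v}
  by_cases hex : ∃ a ∈ I, ∀ v, (a, v) ∉ M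
  · obtain ⟨a, haI, ha⟩ := hex
    set X : Set V := {u | ∃ n, AltReach Q M a n u}
    set Y : Set V := {y | ∃ u ∈ X, Q.Adj u y}
    have haX : a ∈ X := ⟨0, rfl⟩
    have hXP : X ⊆ ↑P := by
      rintro u ⟨_ | n, hu⟩
      · obtain rfl : u = a := hu
        exact hIP haI
      · obtain ⟨-, y, -, -, huy⟩ := hu
        exact (hM.1 _ huy).1
    have hmat : ∀ y ∈ Y, ∃ u, (u, y) ∈ M := by
      rintro y ⟨u, ⟨n, hu⟩, huy⟩
      exact exists_mem_of_altReach Q P a (hIP haI) n M hM hMmax ha u y hu huy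
    have hback : ∀ y ∈ Y, ∀ u, (u, y) ∈ M → u ∈ X := by
      rintro y ⟨v, ⟨n, hv⟩, hvy⟩ u hu
      exact ⟨n + 1, v, y, hv, hvy, hu⟩
    choose! g hg using hmat
    have hgC : Set.MapsTo g (X ∩ Y) (X ∩ Y) := fun c hc =>
      ⟨hback c hc.2 _ (hg c hc.2), c, hc.1, (hM.1 _ (hg c hc.2)).2.symm⟩
    have hginj : Set.InjOn g (X ∩ Y) := fun c hc d hd h =>
      congrArg Prod.snd (hM.2.1 _ (hg c hc.2) _ (hg d hd.2) h)
    have hgsurj : Set.SurjOn g (X ∩ Y) (X ∩ Y) :=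
      hgC.surjOn_of_injOn_of_ncard_le hginj le_rfl
    -- every `x_c` with `c ∈ X ∩ Y` is matched to some `y_d` with `d ∈ X ∩ Y`
    have hC : ∀ c ∈ X, c ∈ Y → ∃ d ∈ X, (c, d) ∈ M := fun c hcX hcY => by
      obtain ⟨d, hd, rfl⟩ := hgsurj ⟨hcX, hcY⟩
      exact ⟨d, hd.1, hg d hd.2⟩
    refine exists_isTailSCC_of_closed Q P hIso M (X \ Y) (Y \ X) ⟨a, haX, fun haY => ?_⟩
      (Set.sdiff_subset.trans hXP) (Set.disjoint_left.mpr fun v hv hv' => hv.2 hv'.1)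
      (fun u hu v huv => ⟨⟨u, hu.1, huv⟩, fun hv => hu.2 ⟨v, hv, huv.symm⟩⟩)
      (fun v hv => ⟨g v, hg v hv.1⟩) fun v hv u huv => ⟨hback v hv.1 u huv, fun huY => ?_⟩
    · obtain ⟨d, -, hd⟩ := hC a haX haY
      exact ha d hd
    · obtain ⟨d, hdX, hd⟩ := hC u (hback v hv.1 u huv) huY
      obtain rfl : v = d := congrArg Prod.snd (hM.2.1 _ huv _ hd rfl)
      exact hv.2 hdX
  · push Not at hex
    choose! g hg using hex
    have hgH : Set.MapsTo g I H := fun i hi => ⟨i, hi, (hM.1 _ (hg i hi)).2⟩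
    have hginj : Set.InjOn g I := fun i hi j hj h =>
      congrArg Prod.fst (hM.2.2 _ (hg i hi) _ (hg j hj) h)
    have hcard : H.ncard ≤ I.ncard :=
      Set.ncard_le_ncard_of_injOn f (fun v hv => (hfI v hv).1) hf
    have hsurj : Set.SurjOn g I H :=
      hgH.surjOn_of_injOn_of_ncard_le hginj hcard
    refine exists_isTailSCC_of_closed Q P hIso M I H hI hIP
      (Set.disjoint_left.mpr fun v hv ⟨u, hu, huv⟩ => hind u hu v hv huv)
      (fun u hu v huv => ⟨u, hu, huv⟩) (fun v hv => ?_) fun v hv u huv => ?_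
    · obtain ⟨i, hi, rfl⟩ := hsurj hv
      exact ⟨i, hg i hi⟩
    · obtain ⟨i, hi, rfl⟩ := hsurj hv
      obtain rfl : u = i := congrArg Prod.fst (hM.2.2 _ huv _ (hg i hi) rfl)
      exact hi
end

section
/- Let G be a finite simple graph and R ⊆ V(G). If the independence number of the induced subgraph G[R] satisfies α(G[R]) > |V(G)|/2, then G contains a crown (I, H) with I ⊆ R and |I| > |H|. -/
/-- Independence number of the subgraph of `G` induced by `R`: the maximum size of a
set of pairwise nonadjacent vertices inside `R`. -/
noncomputable def indepNumOn {V : Type*} (G : SimpleGraph V) (R : Set V) : ℕ :=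
  sSup {n | ∃ I : Finset V, ↑I ⊆ R ∧ (∀ u ∈ I, ∀ v ∈ I, ¬ G.Adj u v) ∧ I.card = n}

/-- The neighbourhood of a finite vertex set, as a finset. -/
noncomputable def SimpleGraph.neighborFinsetOf {V : Type*} [Fintype V] (G : SimpleGraph V)
    (I : Finset V) : Finset V :=
  open Classical in {v | ∃ u ∈ I, G.Adj u v}

@[simp]
theorem SimpleGraph.mem_neighborFinsetOf {V : Type*} [Fintype V] {G : SimpleGraph V}
    {I : Finset V} {v : V} : v ∈ G.neighborFinsetOf I ↔ ∃ u ∈ I, G.Adj u v := by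
  simp [neighborFinsetOf]

theorem exists_finset_card_eq_indepNumOn {V : Type*} [Fintype V] (G : SimpleGraph V)
    (R : Set V) :
    ∃ I : Finset V, ↑I ⊆ R ∧ (∀ u ∈ I, ∀ v ∈ I, ¬ G.Adj u v) ∧ I.card = indepNumOn G R := by
  refine Nat.sSup_mem
    (s := {n | ∃ I : Finset V, ↑I ⊆ R ∧ (∀ u ∈ I, ∀ v ∈ I, ¬ G.Adj u v) ∧ I.card = n})
    ⟨0, ∅, by simp⟩ ⟨Fintype.card V, ?_⟩
  rintro n ⟨I, -, -, rfl⟩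
  exact I.card_le_univ

/-- If `I` has the largest surplus `|I| - |N(I)|` among its subsets, then `N(I)` can be matched
into `I`. -/
theorem exists_matching_of_maximal_surplus {V : Type*} [Fintype V] (G : SimpleGraph V)
    (I : Finset V)
    (hmax : ∀ J ⊆ I, J.card + (G.neighborFinsetOf I).card ≤
      I.card + (G.neighborFinsetOf J).card) :
    ∃ f : V → V, Set.InjOn f (G.neighborFinsetOf I) ∧
      ∀ v ∈ G.neighborFinsetOf I, f v ∈ I ∧ G.Adj v (f v) := by
  classical
  let t : G.neighborFinsetOf I → Finset V := fun v => I.filter (G.Adj v)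
  have hall : ∀ s : Finset (G.neighborFinsetOf I), s.card ≤ (s.biUnion t).card := by
    intro s
    have hsub : s.biUnion t ⊆ I :=
      Finset.biUnion_subset.2 fun v _ => Finset.filter_subset _ _
    have hJ := hmax (I \ s.biUnion t) Finset.sdiff_subset
    have hT : s.map (Function.Embedding.subtype _) ⊆ G.neighborFinsetOf I := by
      intro v hv
      obtain ⟨w, -, rfl⟩ := Finset.mem_map.1 hv
      exact w.2
    have hN : G.neighborFinsetOf (I \ s.biUnion t) ⊆
        G.neighborFinsetOf I \ s.map (Function.Embedding.subtype _) := by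
      intro v hv
      obtain ⟨u, hu, huv⟩ := SimpleGraph.mem_neighborFinsetOf.1 hv
      obtain ⟨huI, hut⟩ := Finset.mem_sdiff.1 hu
      refine Finset.mem_sdiff.2 ⟨SimpleGraph.mem_neighborFinsetOf.2 ⟨u, huI, huv⟩, fun hvs => ?_⟩
      obtain ⟨w, hw, rfl⟩ := Finset.mem_map.1 hvs
      exact hut (Finset.mem_biUnion.2 ⟨w, hw, Finset.mem_filter.2 ⟨huI, huv.symm⟩⟩)
    have hNcard := Finset.card_le_card hN
    have hTcard := Finset.card_le_card hT
    have hsubcard := Finset.card_le_card hsub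
    rw [Finset.card_sdiff_of_subset hT, Finset.card_map] at hNcard
    rw [Finset.card_map] at hTcard
    rw [Finset.card_sdiff_of_subset hsub] at hJ
    omega
  obtain ⟨f, hinj, hf⟩ := (Finset.all_card_le_biUnion_card_iff_exists_injective t).1 hall
  refine ⟨fun v => if hv : v ∈ G.neighborFinsetOf I then f ⟨v, hv⟩ else v, ?_, ?_⟩
  · intro v hv w hw hvw
    rw [Finset.mem_coe] at hv hw
    simp only [dif_pos hv, dif_pos hw] at hvw
    exact congrArg Subtype.val (hinj hvw)
  · intro v hv
    simp only [dif_pos hv]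
    exact Finset.mem_filter.1 (hf ⟨v, hv⟩)

/-- If `α(G[R]) > |V(G)| / 2`, then `G` contains a crown `(I, H)` with `I ⊆ R`
and `|I| > |H|`. -/
theorem stmt5 {V : Type*} [Fintype V] (G : SimpleGraph V) (R : Set V)
    (h : Fintype.card V < 2 * indepNumOn G R) :
    ∃ I H : Set V, IsCrown G I H ∧ I ⊆ R ∧ H.ncard < I.ncard := by
  classical
  obtain ⟨S, hSR, hS, hScard⟩ := exists_finset_card_eq_indepNumOn G R
  have hdisj : Disjoint S (G.neighborFinsetOf S) := by
    refine Finset.disjoint_left.2 fun v hv hvN => ?_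
    obtain ⟨u, hu, huv⟩ := SimpleGraph.mem_neighborFinsetOf.1 hvN
    exact hS u hu v hv huv
  have hle := (S ∪ G.neighborFinsetOf S).card_le_univ
  rw [Finset.card_union_of_disjoint hdisj] at hle
  obtain ⟨I, hIS, hI⟩ := S.powerset.exists_max_image
    (fun J => (J.card : ℤ) - (G.neighborFinsetOf J).card) ⟨S, Finset.mem_powerset_self S⟩
  rw [Finset.mem_powerset] at hIS
  have hSI := hI S (Finset.mem_powerset_self S)
  have hlt : (G.neighborFinsetOf I).card < I.card := by omega
  obtain ⟨f, hinj, hf⟩ := exists_matching_of_maximal_surplus G I fun J hJ => by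
    have hJI := hI J (Finset.mem_powerset.2 (hJ.trans hIS))
    omega
  refine ⟨I, G.neighborFinsetOf I, ⟨?_, ?_, ?_, f, hinj, hf⟩, ?_, ?_⟩
  · exact Finset.card_pos.1 (by omega)
  · exact fun u hu v hv => hS u (hIS hu) v (hIS hv)
  · ext v
    simp
  · exact (Finset.coe_subset.2 hIS).trans hSR
  · simpa only [Set.ncard_coe_finset] using hlt
end

section
/- Let G be a finite simple graph and B ⊆ V(G) such that G − B is a forest and the independence number of G − B satisfies α(G − B) ≤ |V(G)|/2. Then there exists a set B' with B ⊆ B' ⊆ V(G) and |B'| ≤ 2|B| such that G − B' has a perfect matching. -/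
/-- A finite nonempty forest has a vertex with at most one neighbour. -/
theorem SimpleGraph.IsAcyclic.exists_subsingleton_neighborSet {W : Type*} [Finite W] [Nonempty W]
    {H : SimpleGraph W} (h : H.IsAcyclic) : ∃ v, (H.neighborSet v).Subsingleton := by
  have : Finite H.edgeSet := Subtype.finite
  obtain ⟨u, v, p, hp, hmax⟩ := SimpleGraph.Walk.exists_isPath_forall_isPath_length_le_length H
  have key : ∀ w, H.Adj u w → w = p.snd := by
    intro w hadj
    apply h.eq_snd_of_adj_start hp hadj
    by_contra hw
    have := hmax _ _ _ (hp.cons (h := hadj.symm) hw)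
    simp at this
  exact ⟨u, fun a ha b hb ↦ (key a ha).trans (key b hb).symm⟩

/-- Every finite induced forest has a matching, with vertex set `M`, and an independent set `I`
with `|R| - |M| / 2 ≤ |I|`. -/
theorem exists_indep_matching_of_isAcyclic {V : Type*} [DecidableEq V] (G : SimpleGraph V)
    (R : Finset V) (hR : (G.induce (↑R : Set V)).IsAcyclic) :
    ∃ I M : Finset V, I ⊆ R ∧ M ⊆ R ∧ (∀ u ∈ I, ∀ v ∈ I, ¬ G.Adj u v) ∧
      (∃ f : V → V, ∀ v ∈ M, G.Adj v (f v) ∧ f v ∈ M ∧ f (f v) = v) ∧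
      2 * R.card ≤ M.card + 2 * I.card := by
  induction R using Finset.strongInduction with
  | H R ih =>
    have hsub : ∀ S ⊆ R, (G.induce (↑S : Set V)).IsAcyclic := fun S hS ↦
      hR.embedding (G.induceHomOfLE (Finset.coe_subset.mpr hS))
    rcases R.eq_empty_or_nonempty with rfl | hne
    · exact ⟨∅, ∅, by simp, by simp, by simp, ⟨id, by simp⟩, by simp⟩
    have : Nonempty (↑R : Set V) := hne.to_subtype
    obtain ⟨⟨v, hv⟩, hleaf⟩ := hR.exists_subsingleton_neighborSet
    replace hv : v ∈ R := hv
    by_cases hw : ∃ w ∈ R, G.Adj v w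
    · obtain ⟨w, hwR, hvw⟩ := hw
      have huniq : ∀ x ∈ R, G.Adj v x → x = w := fun x hx hvx ↦
        congrArg Subtype.val (@hleaf ⟨x, hx⟩ hvx ⟨w, hwR⟩ hvw)
      have hne' : v ≠ w := hvw.ne
      have hss : (R.erase v).erase w ⊆ R := by grind
      obtain ⟨I, M, hI, hM, hind, ⟨f, hf⟩, hcard⟩ := ih ((R.erase v).erase w)
        (Finset.ssubset_iff_subset_ne.mpr ⟨hss, by grind⟩) (hsub _ hss)
      have hvI : v ∉ I := by grind
      have hwM : w ∉ M := by grind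
      have hvM : v ∉ insert w M := by grind
      refine ⟨insert v I, insert v (insert w M), by grind, by grind, ?_,
        ⟨fun x ↦ if x = v then w else if x = w then v else f x, ?_⟩, ?_⟩
      · have hvx : ∀ x ∈ I, ¬ G.Adj v x := by grind
        intro a ha b hb
        rcases Finset.mem_insert.mp ha with rfl | haI <;>
          rcases Finset.mem_insert.mp hb with rfl | hbI
        · exact G.irrefl
        · exact hvx b hbI
        · exact fun h ↦ hvx a haI h.symm
        · exact hind a haI b hbI
      · have := hvw.symm
        grind
      · rw [Finset.card_insert_of_notMem hvI, Finset.card_insert_of_notMem hvM,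
          Finset.card_insert_of_notMem hwM]
        rw [Finset.card_erase_of_mem (by grind), Finset.card_erase_of_mem hv] at hcard
        omega
    · push Not at hw
      have hss := R.erase_subset v
      obtain ⟨I, M, hI, hM, hind, hf, hcard⟩ := ih (R.erase v)
        (Finset.erase_ssubset hv) (hsub _ hss)
      have hvI : v ∉ I := by grind
      refine ⟨insert v I, M, by grind, by grind, ?_, hf, ?_⟩
      · intro a ha b hb
        rcases Finset.mem_insert.mp ha with rfl | haI <;>
          rcases Finset.mem_insert.mp hb with rfl | hbI
        · exact G.irrefl
        · exact hw b (by grind)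
        · exact fun h ↦ hw a (by grind) h.symm
        · exact hind a haI b hbI
      · rw [Finset.card_insert_of_notMem hvI]
        rw [Finset.card_erase_of_mem hv] at hcard
        omega

/-- If `G − B` is a forest and `α(G − B) ≤ |V(G)| / 2`, then there is a set `B'` with
`B ⊆ B' ⊆ V(G)` and `|B'| ≤ 2|B|` such that `G − B'` has a perfect matching
(encoded as an adjacency-preserving involution on `V(G) \ B'`). -/
theorem stmt6 {V : Type*} [Fintype V] [DecidableEq V] (G : SimpleGraph V) (B : Finset V)
    (hforest : (G.induce ((↑B : Set V)ᶜ)).IsAcyclic)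
    (halpha : 2 * indepNumOn G ((↑B : Set V)ᶜ) ≤ Fintype.card V) :
    ∃ B' : Finset V, B ⊆ B' ∧ B'.card ≤ 2 * B.card ∧
      ∃ f : V → V, ∀ v ∉ B', G.Adj v (f v) ∧ f v ∉ B' ∧ f (f v) = v := by
  obtain ⟨I, M, hI, hM, hind, ⟨f, hf⟩, hcard⟩ :=
    exists_indep_matching_of_isAcyclic G Bᶜ (by rwa [Finset.coe_compl])
  have hIα : I.card ≤ indepNumOn G ((↑B : Set V)ᶜ) := by
    refine le_csSup ⟨Fintype.card V, ?_⟩ ⟨I, ?_, hind, rfl⟩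
    · rintro n ⟨J, -, -, rfl⟩
      exact J.card_le_univ
    · rw [← Finset.coe_compl]
      exact_mod_cast hI
  have hB := B.card_add_card_compl
  have hMc := M.card_add_card_compl
  refine ⟨Mᶜ, fun b hb ↦ ?_, by omega, f, fun v hv ↦ ?_⟩
  · exact Finset.mem_compl.mpr fun hbM ↦ Finset.mem_compl.mp (hM hbM) hb
  · simpa using hf v (by simpa using hv)
end

section
/- Let i and j be natural numbers with i < j, and let G be the graph with vertex set {x, y} ∪ U ∪ W ∪ Z, where U, W, Z are pairwise disjoint sets avoiding x and y with |U| = |W| = j and |Z| = i, and whose edge set consists of: all pairs {u, w} with u ∈ U and w ∈ W; the pairs {x, u} for all u ∈ U; the pairs {y, w} for all w ∈ W; and the pairs {x, z} and {y, z} for all z ∈ Z. Then the maximum cut value of G equals j² + 2j + i. -/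
/-- The maximum cut value of `G`: the maximum, over all vertex sets `X`, of the number
of edges of `G` with one endpoint in `X` and one endpoint outside `X`. -/
noncomputable def mcNum {V : Type*} (G : SimpleGraph V) : ℕ :=
  sSup {n | ∃ X : Finset V,
    n = Set.ncard {e : Sym2 V | ∃ u v, e = s(u, v) ∧ G.Adj u v ∧ u ∈ X ∧ v ∉ X}}

/-- The number of pairs of a rectangle `A ×ˢ B` that are separated by `X`. -/
theorem card_filter_product_separated {V : Type*} [DecidableEq V] (A B X : Finset V) :
    ((A ×ˢ B).filter (fun p => p.1 ∈ X ↔ p.2 ∉ X)).card =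
      (A.filter (· ∈ X)).card * (B.filter (· ∉ X)).card +
        (A.filter (· ∉ X)).card * (B.filter (· ∈ X)).card := by
  rw [← Finset.card_product, ← Finset.card_product, ← Finset.card_union_of_disjoint]
  · congr 1
    ext ⟨a, b⟩
    simp only [Finset.mem_filter, Finset.mem_product, Finset.mem_union]
    tauto
  · rw [Finset.disjoint_left]
    rintro ⟨a, b⟩
    simp only [Finset.mem_filter, Finset.mem_product]
    tauto

/-- If the edges of `G` are listed once each by the set `P` of ordered pairs, a cut is counted by
the pairs of `P` that it separates. -/
theorem ncard_cut_eq_card_filter {V : Type*} [DecidableEq V] (G : SimpleGraph V)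
    (P : Finset (V × V)) (hP : ∀ u v, G.Adj u v ↔ (u, v) ∈ P ∨ (v, u) ∈ P)
    (hanti : ∀ u v, (u, v) ∈ P → (v, u) ∉ P) (X : Finset V) :
    Set.ncard {e : Sym2 V | ∃ u v, e = s(u, v) ∧ G.Adj u v ∧ u ∈ X ∧ v ∉ X} =
      (P.filter (fun p => p.1 ∈ X ↔ p.2 ∉ X)).card := by
  have himage : {e : Sym2 V | ∃ u v, e = s(u, v) ∧ G.Adj u v ∧ u ∈ X ∧ v ∉ X} =
      ((P.filter (fun p => p.1 ∈ X ↔ p.2 ∉ X)).image (fun p => s(p.1, p.2)) :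
        Finset (Sym2 V)) := by
    ext e
    simp only [Set.mem_ofPred_eq, Finset.coe_image, Set.mem_image, Finset.mem_coe,
      Finset.mem_filter, Prod.exists]
    constructor
    · rintro ⟨u, v, rfl, hadj, hu, hv⟩
      rcases (hP u v).1 hadj with h | h
      · exact ⟨u, v, ⟨h, by tauto⟩, rfl⟩
      · exact ⟨v, u, ⟨h, by tauto⟩, Sym2.eq_swap⟩
    · rintro ⟨u, v, ⟨h, hsep⟩, rfl⟩
      by_cases hu : u ∈ X
      · exact ⟨u, v, rfl, (hP u v).2 (Or.inl h), hu, hsep.1 hu⟩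
      · exact ⟨v, u, Sym2.eq_swap, (hP v u).2 (Or.inr h), by tauto, hu⟩
  rw [himage, Set.ncard_coe_finset, Finset.card_image_of_injOn]
  rintro ⟨a, b⟩ hab ⟨c, d⟩ hcd heq
  simp only [Finset.coe_filter, Set.mem_ofPred_eq] at hab hcd
  rcases Sym2.eq_iff.1 heq with ⟨h₁, h₂⟩ | ⟨h₁, h₂⟩
  · exact Prod.ext h₁ h₂
  · simp only at h₁ h₂
    subst h₁ h₂
    exact absurd hcd.1 (hanti _ _ hab.1)

/-- The cut inequality when both apexes lie on the same side; `a`, `b`, `c` count the vertices of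
the three classes on that side and `a'`, `b'`, `c'` those on the other. -/
theorem cut_le_of_same_side {a a' b b' c c' i j : ℕ} (ha : a + a' = j) (hb : b + b' = j)
    (hc : c + c' = i) (hij : i < j) :
    a * b' + a' * b + a' + b' + c' + c' ≤ j ^ 2 + 2 * j + i := by
  have hsq : j ^ 2 = a * b + a * b' + a' * b + a' * b' := by
    calc j ^ 2 = (a + a') * (b + b') := by rw [ha, hb, sq]
      _ = _ := by ring
  have hkey : i ≤ a * b + a' * b' + a + b := by
    rcases Nat.eq_zero_or_pos a' with h | h
    · have := Nat.zero_le (a * b + a' * b')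
      omega
    rcases Nat.eq_zero_or_pos b' with h' | h'
    · have := Nat.zero_le (a * b + a' * b')
      omega
    nlinarith [Nat.zero_le (a * b), Nat.mul_le_mul_left a' h']
  omega

/-- The maximum cut value of the graph on `{x, y} ∪ U ∪ W ∪ Z` (with `|U| = |W| = j`,
`|Z| = i`, `i < j`) consisting of the complete bipartite graph between `U` and `W`,
all edges from `x` to `U ∪ Z`, and all edges from `y` to `W ∪ Z`, equals
`j² + 2j + i`. -/
theorem stmt11 {V : Type*} [DecidableEq V] (x y : V) (U W Z : Finset V) (i j : ℕ)
    (hxy : x ≠ y)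
    (hxU : x ∉ U) (hxW : x ∉ W) (hxZ : x ∉ Z)
    (hyU : y ∉ U) (hyW : y ∉ W) (hyZ : y ∉ Z)
    (hUW : Disjoint U W) (hUZ : Disjoint U Z) (hWZ : Disjoint W Z)
    (hU : U.card = j) (hW : W.card = j) (hZ : Z.card = i) (hij : i < j)
    (hall : ∀ v : V, v = x ∨ v = y ∨ v ∈ U ∨ v ∈ W ∨ v ∈ Z)
    (G : SimpleGraph V)
    (hG : ∀ u v, G.Adj u v ↔
      ((u ∈ U ∧ v ∈ W) ∨ (u ∈ W ∧ v ∈ U) ∨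
       (u = x ∧ v ∈ U) ∨ (u ∈ U ∧ v = x) ∨
       (u = y ∧ v ∈ W) ∨ (u ∈ W ∧ v = y) ∨
       (u = x ∧ v ∈ Z) ∨ (u ∈ Z ∧ v = x) ∨
       (u = y ∧ v ∈ Z) ∨ (u ∈ Z ∧ v = y))) :
    mcNum G = j ^ 2 + 2 * j + i := by
  have hUW' := Finset.disjoint_left.1 hUW
  have hUZ' := Finset.disjoint_left.1 hUZ
  have hWZ' := Finset.disjoint_left.1 hWZ
  have hcut : ∀ X : Finset V,
      Set.ncard {e : Sym2 V | ∃ u v, e = s(u, v) ∧ G.Adj u v ∧ u ∈ X ∧ v ∉ X} =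
        ((U ×ˢ W).filter (fun p => p.1 ∈ X ↔ p.2 ∉ X)).card +
        (({x} ×ˢ U).filter (fun p => p.1 ∈ X ↔ p.2 ∉ X)).card +
        (({y} ×ˢ W).filter (fun p => p.1 ∈ X ↔ p.2 ∉ X)).card +
        (({x} ×ˢ Z).filter (fun p => p.1 ∈ X ↔ p.2 ∉ X)).card +
        (({y} ×ˢ Z).filter (fun p => p.1 ∈ X ↔ p.2 ∉ X)).card := by
    intro X
    rw [ncard_cut_eq_card_filter G
      (U ×ˢ W ∪ {x} ×ˢ U ∪ {y} ×ˢ W ∪ {x} ×ˢ Z ∪ {y} ×ˢ Z)]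
    · simp only [Finset.filter_union]
      repeat rw [Finset.card_union_of_disjoint]
      all_goals
        rw [Finset.disjoint_left]
        rintro ⟨a, b⟩
        simp only [Finset.mem_union, Finset.mem_filter, Finset.mem_product,
          Finset.mem_singleton]
        grind
    · intro u v
      rw [hG]
      simp only [Finset.mem_union, Finset.mem_product, Finset.mem_singleton]
      constructor
      · rintro (⟨h₁, h₂⟩ | ⟨h₁, h₂⟩ | ⟨h₁, h₂⟩ | ⟨h₁, h₂⟩ | ⟨h₁, h₂⟩ | ⟨h₁, h₂⟩ |
          ⟨h₁, h₂⟩ | ⟨h₁, h₂⟩ | ⟨h₁, h₂⟩ | ⟨h₁, h₂⟩) <;> simp [h₁, h₂]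
      · rintro (((((⟨h₁, h₂⟩ | ⟨h₁, h₂⟩) | ⟨h₁, h₂⟩) | ⟨h₁, h₂⟩) | ⟨h₁, h₂⟩) |
          ((((⟨h₁, h₂⟩ | ⟨h₁, h₂⟩) | ⟨h₁, h₂⟩) | ⟨h₁, h₂⟩) | ⟨h₁, h₂⟩)) <;> simp [h₁, h₂]
    · intro u v
      simp only [Finset.mem_union, Finset.mem_product, Finset.mem_singleton]
      grind
  simp only [card_filter_product_separated, Finset.filter_singleton] at hcut
  have hsplit : ∀ A X : Finset V,
      (A.filter (· ∈ X)).card + (A.filter (· ∉ X)).card = A.card :=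
    fun A X => Finset.card_filter_add_card_filter_not _
  refine IsGreatest.csSup_eq ⟨⟨insert x W, ?_⟩, ?_⟩
  · have hUin : U.filter (· ∈ insert x W) = ∅ := by
      ext v; simp only [Finset.mem_filter, Finset.mem_insert, Finset.notMem_empty]; grind
    have hWout : W.filter (· ∉ insert x W) = ∅ := by
      ext v; simp only [Finset.mem_filter, Finset.mem_insert, Finset.notMem_empty]; grind
    have hUs := hsplit U (insert x W)
    have hWs := hsplit W (insert x W)
    have hZs := hsplit Z (insert x W)
    have hx : x ∈ insert x W := Finset.mem_insert_self x W
    have hy : y ∉ insert x W := by simp [hxy.symm, hyW]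
    rw [hUin, Finset.card_empty, zero_add, hU] at hUs
    rw [hWout, Finset.card_empty, add_zero, hW] at hWs
    rw [hcut, hUin, hWout, hUs, hWs]
    simp only [hx, hy, not_true_eq_false, not_false_eq_true, if_true, if_false,
      Finset.card_empty, Finset.card_singleton]
    linarith
  · rintro n ⟨X, rfl⟩
    have hUs := (hsplit U X).trans hU
    have hWs := (hsplit W X).trans hW
    have hZs := (hsplit Z X).trans hZ
    rw [hcut]
    have hsame := cut_le_of_same_side hUs hWs hZs hij
    have hsame' := cut_le_of_same_side ((add_comm _ _).trans hUs) ((add_comm _ _).trans hWs)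
      ((add_comm _ _).trans hZs) hij
    generalize (U.filter (· ∈ X)).card = a at *
    generalize (U.filter (· ∉ X)).card = a' at *
    generalize (W.filter (· ∈ X)).card = b at *
    generalize (W.filter (· ∉ X)).card = b' at *
    have hsq : j ^ 2 = a * b + a * b' + a' * b + a' * b' := by
      calc j ^ 2 = (a + a') * (b + b') := by rw [hUs, hWs, sq]
        _ = _ := by ring
    by_cases hx : x ∈ X <;> by_cases hy : y ∈ X <;>
      simp only [hx, hy, not_true_eq_false, not_false_eq_true, if_true, if_false,
        Finset.card_empty, Finset.card_singleton, one_mul, zero_mul, add_zero, zero_add] <;>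
      nlinarith [Nat.zero_le (a * b), Nat.zero_le (a' * b')]
end

section
/- For each i ∈ ℕ let G^i be the graph with vertex set {x, y} ∪ {v_1, …, v_i} (all distinct) whose edges are exactly {x, v_t} and {y, v_t} for t = 1, …, i, regarded as a boundaried graph with boundary B = {x, y}; note G^i − B is an independent set. Then for all distinct i, j ∈ ℕ, the boundaried graphs G^i_B and G^j_B are not gluing equivalent with respect to the maximum cut value: there is no integer Δ such that mc(G^i_B ⊕ H_B) = mc(G^j_B ⊕ H_B) + Δ for every boundaried graph H_B with V(H) ∩ V(G^i) ⊆ B and V(H) ∩ V(G^j) ⊆ B. In particular, Maximum Cut does not have finite integer index, even on boundaried graphs with G − B an independent set. -/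
/-- A boundaried/finite graph: a simple graph on ambient type `V` whose edges
lie within a finite vertex set `verts`. -/
structure BGraph (V : Type*) where
  verts : Finset V
  graph : SimpleGraph V
  support : ∀ ⦃u v : V⦄, graph.Adj u v → u ∈ verts ∧ v ∈ verts

/-- Gluing of two boundaried graphs: union of vertex sets and of edge sets. -/
def BGraph.glue {V : Type*} [DecidableEq V] (A H : BGraph V) : BGraph V where
  verts := A.verts ∪ H.verts
  graph := A.graph ⊔ H.graph
  support := by
    intro u v h
    rcases h with h | h
    · exact ⟨Finset.mem_union_left _ (A.support h).1, Finset.mem_union_left _ (A.support h).2⟩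
    · exact ⟨Finset.mem_union_right _ (H.support h).1, Finset.mem_union_right _ (H.support h).2⟩

/-- The maximum cut value of a boundaried graph: the maximum, over all vertex sets `X`,
of the number of edges with one endpoint in `X` and one endpoint outside `X`. -/
noncomputable def mcNumB {V : Type*} (A : BGraph V) : ℕ :=
  sSup {n | ∃ X : Finset V,
    n = Set.ncard {e : Sym2 V | ∃ u v, e = s(u, v) ∧ A.graph.Adj u v ∧ u ∈ X ∧ v ∉ X}}

/-- The cut induced by `X`, counted along an injective enumeration `e` of the edges. -/
theorem BGraph.ncard_cut_eq_sum {V ι : Type*} [DecidableEq V] [Fintype ι] (A : BGraph V)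
    (e : ι → V × V) (he : Function.Injective fun k => s((e k).1, (e k).2))
    (hA : ∀ u v, A.graph.Adj u v ↔ ∃ k, s((e k).1, (e k).2) = s(u, v)) (X : Finset V) :
    Set.ncard {d : Sym2 V | ∃ u v, d = s(u, v) ∧ A.graph.Adj u v ∧ u ∈ X ∧ v ∉ X} =
      ∑ k, if ((e k).1 ∈ X ↔ (e k).2 ∈ X) then 0 else 1 := by
  classical
  have hcut : {d : Sym2 V | ∃ u v, d = s(u, v) ∧ A.graph.Adj u v ∧ u ∈ X ∧ v ∉ X} =
      (fun k => s((e k).1, (e k).2)) '' {k | ¬((e k).1 ∈ X ↔ (e k).2 ∈ X)} := by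
    ext d
    simp only [Set.mem_ofPred_eq, Set.mem_image]
    constructor
    · rintro ⟨u, v, rfl, h, hu, hv⟩
      obtain ⟨k, hk⟩ := (hA u v).1 h
      refine ⟨k, ?_, hk⟩
      rcases Sym2.eq_iff.1 hk with ⟨h1, h2⟩ | ⟨h1, h2⟩ <;> simp [h1, h2, hu, hv]
    · rintro ⟨k, hk, rfl⟩
      by_cases h : (e k).1 ∈ X
      · exact ⟨_, _, rfl, (hA _ _).2 ⟨k, rfl⟩, h, by tauto⟩
      · exact ⟨_, _, Sym2.eq_swap, (hA _ _).2 ⟨k, Sym2.eq_swap⟩, by tauto, h⟩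
  rw [hcut, Set.ncard_image_of_injective _ he, Set.ncard_eq_toFinset_card', Set.toFinset_ofPred,
    Finset.card_filter]
  exact Finset.sum_congr rfl fun k _ => by split_ifs <;> simp_all

/-- The edges of the paths `x, a t, b t, y`. -/
def pathEdge {V ι : Type*} (x y : V) (a b : ι → V) (p : ι × Fin 3) : V × V :=
  ![(x, a p.1), (a p.1, b p.1), (b p.1, y)] p.2

/-- The union of the length-three paths `x, a t, b t, y`. -/
def pathBundle {V ι : Type*} [DecidableEq V] [Fintype ι] (x y : V) (a b : ι → V) : BGraph V where
  verts := {x, y} ∪ (Finset.univ.image a ∪ Finset.univ.image b)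
  graph := SimpleGraph.fromEdgeSet
    (Set.range fun p => s((pathEdge x y a b p).1, (pathEdge x y a b p).2))
  support := by
    intro u v h
    rw [SimpleGraph.fromEdgeSet_adj] at h
    obtain ⟨⟨⟨t, c⟩, hp⟩, -⟩ := h
    fin_cases c <;> simp [pathEdge] at hp ⊢ <;> grind

/-- The edges from `x` and `y` to the vertices of `S`, followed by those of the paths. -/
def spokePathEdge {V ι : Type*} (x y : V) (S : Finset V) (a b : ι → V) :
    S × Bool ⊕ ι × Fin 3 → V × V
  | .inl p => (p.1, if p.2 then x else y)
  | .inr p => pathEdge x y a b p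

theorem spokePathEdge_injective {V ι : Type*} {x y : V} (hxy : x ≠ y) {S : Finset V}
    (hx : x ∉ S) (hy : y ∉ S) {a b : ι → V} (hab : Function.Injective (Sum.elim a b))
    (hS : ∀ k, Sum.elim a b k ∉ S) (hkx : ∀ k, Sum.elim a b k ≠ x)
    (hky : ∀ k, Sum.elim a b k ≠ y) :
    Function.Injective fun k =>
      s((spokePathEdge x y S a b k).1, (spokePathEdge x y S a b k).2) := by
  simp only [Sum.forall, Sum.elim_inl, Sum.elim_inr] at hS hkx hky
  obtain ⟨ha, hb, hne⟩ := Sum.elim_injective.1 hab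
  rintro (⟨⟨v, hv⟩, c⟩ | ⟨s, c⟩) (⟨⟨w, hw⟩, d⟩ | ⟨t, d⟩) h
  · cases c <;> cases d <;> simp [spokePathEdge] at h ⊢ <;> grind
  · cases c <;> fin_cases d <;> simp [spokePathEdge, pathEdge] at h ⊢ <;> grind
  · cases d <;> fin_cases c <;> simp [spokePathEdge, pathEdge] at h ⊢ <;> grind
  · fin_cases c <;> fin_cases d <;> simp [spokePathEdge, pathEdge] at h ⊢ <;> grind

theorem glue_pathBundle_adj_iff {V ι : Type*} [DecidableEq V] [Fintype ι] {x y : V}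
    {S : Finset V} {a b : ι → V} (hab : Function.Injective (Sum.elim a b))
    (hkx : ∀ k, Sum.elim a b k ≠ x) (hky : ∀ k, Sum.elim a b k ≠ y)
    {G : BGraph V} (hG : ∀ u v, G.graph.Adj u v ↔
      ((u ∈ S ∧ (v = x ∨ v = y)) ∨ (v ∈ S ∧ (u = x ∨ u = y)))) (u v : V) :
    (G.glue (pathBundle x y a b)).graph.Adj u v ↔
      ∃ k, s((spokePathEdge x y S a b k).1, (spokePathEdge x y S a b k).2) = s(u, v) := by
  simp only [Sum.forall, Sum.elim_inl, Sum.elim_inr] at hkx hky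
  obtain ⟨-, -, hne⟩ := Sum.elim_injective.1 hab
  have hloop : ∀ p, (pathEdge x y a b p).1 ≠ (pathEdge x y a b p).2 := by
    rintro ⟨t, c⟩
    fin_cases c <;> simp [pathEdge] <;> grind
  rw [Sum.exists]
  refine or_congr ?_ ?_
  · rw [hG]
    simp only [spokePathEdge, Prod.exists, Subtype.exists, Bool.exists_bool, Sym2.eq_iff]
    grind
  · rw [pathBundle, SimpleGraph.fromEdgeSet_adj]
    refine ⟨fun h => h.1, fun h => ⟨h, ?_⟩⟩
    rintro rfl
    obtain ⟨p, hp⟩ := h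
    exact hloop p (by rcases Sym2.eq_iff.1 hp with h | h <;> exact h.1.trans h.2.symm)

/-- Gluing `n` paths of length three between `x` and `y` onto the graph `G^S`. -/
theorem mcNumB_glue_pathBundle {V ι : Type*} [DecidableEq V] [Fintype ι] {x y : V}
    (hxy : x ≠ y) {S : Finset V} (hx : x ∉ S) (hy : y ∉ S) {a b : ι → V}
    (hab : Function.Injective (Sum.elim a b)) (hS : ∀ k, Sum.elim a b k ∉ S)
    (hkx : ∀ k, Sum.elim a b k ≠ x) (hky : ∀ k, Sum.elim a b k ≠ y)
    {G : BGraph V} (hG : ∀ u v, G.graph.Adj u v ↔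
      ((u ∈ S ∧ (v = x ∨ v = y)) ∨ (v ∈ S ∧ (u = x ∨ u = y)))) :
    mcNumB (G.glue (pathBundle x y a b)) =
      max (2 * S.card + 2 * Fintype.card ι) (S.card + 3 * Fintype.card ι) := by
  have hcut := BGraph.ncard_cut_eq_sum _ _ (spokePathEdge_injective hxy hx hy hab hS hkx hky)
    (glue_pathBundle_adj_iff hab hkx hky hG)
  simp only [Fintype.sum_sum_type, Fintype.sum_prod_type, Fin.sum_univ_three, Fintype.sum_bool,
    spokePathEdge, pathEdge, Matrix.cons_val, if_true, Bool.false_eq_true, if_false] at hcut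
  simp only [Sum.forall, Sum.elim_inl, Sum.elim_inr] at hS hkx hky
  obtain ⟨ha, hb, hne⟩ := Sum.elim_injective.1 hab
  have hsum : ∀ p q : ℕ, p * S.card + q * Fintype.card ι = ∑ _ : S, p + ∑ _ : ι, q := by
    intro p q
    simp [mul_comm]
  refine IsGreatest.csSup_eq ⟨?_, ?_⟩
  · rcases max_choice (2 * S.card + 2 * Fintype.card ι) (S.card + 3 * Fintype.card ι)
      with h | h <;> rw [h]
    · refine ⟨{x, y} ∪ Finset.univ.image b, ?_⟩
      rw [hcut, hsum]
      congr 1 <;> refine Finset.sum_congr rfl fun k _ => ?_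
      · have := k.2
        simp only [Finset.mem_union, Finset.mem_insert, Finset.mem_singleton, Finset.mem_image,
          Finset.mem_univ, true_and]
        grind
      · simp only [Finset.mem_union, Finset.mem_insert, Finset.mem_singleton, Finset.mem_image,
          Finset.mem_univ, true_and]
        grind
    · refine ⟨{x} ∪ Finset.univ.image b, ?_⟩
      rw [hcut, ← one_mul S.card, hsum]
      congr 1 <;> refine Finset.sum_congr rfl fun k _ => ?_
      · have := k.2
        simp only [Finset.mem_union, Finset.mem_singleton, Finset.mem_image,
          Finset.mem_univ, true_and]
        grind
      · simp only [Finset.mem_union, Finset.mem_singleton, Finset.mem_image,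
          Finset.mem_univ, true_and]
        grind
  · rintro _ ⟨X, rfl⟩
    rw [hcut]
    by_cases h : x ∈ X ↔ y ∈ X
    · refine le_trans ?_ (le_max_left _ _)
      rw [hsum]
      exact add_le_add (Finset.sum_le_sum fun k _ => by grind)
        (Finset.sum_le_sum fun k _ => by grind)
    · refine le_trans ?_ (le_max_right _ _)
      rw [← one_mul S.card, hsum]
      exact add_le_add (Finset.sum_le_sum fun k _ => by grind)
        (Finset.sum_le_sum fun k _ => by grind)

/-- In an infinite type, finitely many distinct points avoid any finite set. -/
theorem exists_injective_sumElim_notMem {V : Type*} [Infinite V] (F : Finset V) (n : ℕ) :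
    ∃ a b : Fin n → V, Function.Injective (Sum.elim a b) ∧ ∀ k, Sum.elim a b k ∉ F := by
  have : Infinite {v // v ∉ F} := F.finite_toSet.infinite_compl.to_subtype
  let f : Fin n ⊕ Fin n ↪ {v // v ∉ F} :=
    (finSumFinEquiv.toEmbedding.trans Fin.valEmbedding).trans (Infinite.natEmbedding _)
  refine ⟨fun t => f (.inl t), fun t => f (.inr t), ?_, ?_⟩
  · convert Subtype.val_injective.comp f.injective using 1
    ext (t | t) <;> rfl
  · rintro (t | t) <;> exact (f _).2

/-- Maximum Cut does not have finite integer index, even on boundaried graphs whose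
non-boundary part is an independent set: for distinct `i, j`, the graphs `G^i`
consisting of boundary `B = {x, y}` plus an independent set of `i` vertices all
adjacent to both `x` and `y` are pairwise not gluing equivalent with respect to the
maximum cut value. -/
theorem stmt12 {V : Type*} [DecidableEq V] [Infinite V] (x y : V) (hxy : x ≠ y)
    (i j : ℕ) (hij : i ≠ j) (Vi Vj : Finset V)
    (hxVi : x ∉ Vi) (hyVi : y ∉ Vi) (hiV : Vi.card = i)
    (hxVj : x ∉ Vj) (hyVj : y ∉ Vj) (hjV : Vj.card = j)
    (Gi Gj : BGraph V)
    (hvi : Gi.verts = insert x (insert y Vi))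
    (hvj : Gj.verts = insert x (insert y Vj))
    (hGi : ∀ u v, Gi.graph.Adj u v ↔
      ((u ∈ Vi ∧ (v = x ∨ v = y)) ∨ (v ∈ Vi ∧ (u = x ∨ u = y))))
    (hGj : ∀ u v, Gj.graph.Adj u v ↔
      ((u ∈ Vj ∧ (v = x ∨ v = y)) ∨ (v ∈ Vj ∧ (u = x ∨ u = y)))) :
    ¬ ∃ Δ : ℤ, ∀ H : BGraph V, x ∈ H.verts → y ∈ H.verts →
      H.verts ∩ Gi.verts ⊆ {x, y} → H.verts ∩ Gj.verts ⊆ {x, y} →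
      (mcNumB (Gi.glue H) : ℤ) = mcNumB (Gj.glue H) + Δ := by
  rintro ⟨Δ, hΔ⟩
  have key : ∀ n : ℕ, (max (2 * i + 2 * n) (i + 3 * n) : ℤ) =
      max (2 * j + 2 * n) (j + 3 * n) + Δ := by
    intro n
    obtain ⟨a, b, hab, hF⟩ := exists_injective_sumElim_notMem (Gi.verts ∪ Gj.verts) n
    simp only [hvi, hvj, Finset.mem_union, Finset.mem_insert, not_or] at hF
    have h := hΔ (pathBundle x y a b) (by simp [pathBundle]) (by simp [pathBundle]) ?_ ?_
    · rw [mcNumB_glue_pathBundle hxy hxVi hyVi hab (fun k => (hF k).1.2.2)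
          (fun k => (hF k).1.1) (fun k => (hF k).1.2.1) hGi,
        mcNumB_glue_pathBundle hxy hxVj hyVj hab (fun k => (hF k).2.2.2)
          (fun k => (hF k).1.1) (fun k => (hF k).1.2.1) hGj, hiV, hjV, Fintype.card_fin] at h
      exact_mod_cast h
    all_goals
      simp only [Sum.forall, Sum.elim_inl, Sum.elim_inr] at hF
      intro v hv
      simp only [pathBundle, hvi, hvj, Finset.mem_inter, Finset.mem_union, Finset.mem_insert,
        Finset.mem_singleton, Finset.mem_image, Finset.mem_univ, true_and] at hv ⊢
      grind
  have h0 := key 0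
  have h1 := key (i + j)
  push_cast at h0 h1
  omega
end

section
/- Let i and j be natural numbers with 1 ≤ i < j and set h = j + 1. For m ∈ ℕ let F(m) be the graph with vertex set {x, r} ∪ {v_1, …, v_m} ∪ {a_1, b_1, …, a_h, b_h} (all distinct) whose edges are: {x, v_t} for each t ∈ {1, …, m}, and for each n ∈ {1, …, h} the edges {a_n, b_n}, {x, a_n}, {x, b_n}, and {r, a_n}. Then the tree deletion number satisfies tds(F(i)) ≤ i + 1 and tds(F(j)) ≥ j + 1. -/
/-- The tree deletion number of `G`: the minimum size of a vertex set `S` such that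
`G − S` is a tree. -/
noncomputable def tdsNum {V : Type*} (G : SimpleGraph V) : ℕ :=
  sInf {n | ∃ S : Finset V, (G.induce ((↑S : Set V)ᶜ)).IsTree ∧ S.card = n}

/-- Vertex type of the graph `F(m)` (with `h` pairs `a_n, b_n`): the vertices `x`,
`r`, `v_1, …, v_m`, `a_1, …, a_h`, `b_1, …, b_h`. -/
abbrev FV (m h : ℕ) : Type := Unit ⊕ Unit ⊕ Fin m ⊕ Fin h ⊕ Fin h

/-- The vertex `x`. -/
abbrev fvx (m h : ℕ) : FV m h := Sum.inl ()
/-- The vertex `r`. -/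
abbrev fvr (m h : ℕ) : FV m h := Sum.inr (Sum.inl ())
/-- The vertex `v_t`. -/
abbrev fvv (m h : ℕ) (t : Fin m) : FV m h := Sum.inr (Sum.inr (Sum.inl t))
/-- The vertex `a_n`. -/
abbrev fva (m h : ℕ) (n : Fin h) : FV m h := Sum.inr (Sum.inr (Sum.inr (Sum.inl n)))
/-- The vertex `b_n`. -/
abbrev fvb (m h : ℕ) (n : Fin h) : FV m h := Sum.inr (Sum.inr (Sum.inr (Sum.inr n)))

/-- The graph `F(m)`: edges `{x, v_t}` for all `t`, and for each `n ≤ h` the edges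
`{a_n, b_n}`, `{x, a_n}`, `{x, b_n}`, `{r, a_n}`. -/
def Fgraph (m h : ℕ) : SimpleGraph (FV m h) :=
  SimpleGraph.fromRel (fun u v =>
    (∃ t : Fin m, u = fvx m h ∧ v = fvv m h t) ∨
    (∃ n : Fin h,
      (u = fva m h n ∧ v = fvb m h n) ∨ (u = fvx m h ∧ v = fva m h n) ∨
      (u = fvx m h ∧ v = fvb m h n) ∨ (u = fvr m h ∧ v = fva m h n)))

lemma SimpleGraph.Connected.isTree_of_parent {V : Type*} [Finite V] {G : SimpleGraph V}
    (hG : G.Connected) (root : V) (parent : V → V)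
    (h : ∀ u v, G.Adj u v → (u ≠ root ∧ parent u = v) ∨ (v ≠ root ∧ parent v = u)) :
    G.IsTree := by
  rw [SimpleGraph.isTree_iff_connected_and_card]
  refine ⟨hG, le_antisymm ?_ hG.card_vert_le_card_edgeSet_add_one⟩
  have hsub : G.edgeSet ⊆ Set.image (fun v => s(v, parent v)) {root}ᶜ := by
    intro e
    induction e with | _ u v => ?_
    intro he
    rcases h u v he with ⟨hu, rfl⟩ | ⟨hv, rfl⟩
    · exact ⟨u, hu, rfl⟩
    · exact ⟨v, hv, Sym2.eq_swap⟩
  have hle := (Set.ncard_le_ncard hsub (Set.toFinite _)).trans (Set.ncard_image_le (Set.toFinite _))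
  have hc := Set.ncard_add_ncard_compl ({root} : Set V)
  rw [Set.ncard_singleton] at hc
  rw [Nat.card_coe_set_eq]
  omega

/-- The deletion set `{x, v_1, …, v_m}`. -/
def centerAndLeaves (m h : ℕ) : Finset (FV m h) :=
  insert (fvx m h) (Finset.univ.image (fvv m h))

lemma card_centerAndLeaves_le (m h : ℕ) : (centerAndLeaves m h).card ≤ m + 1 := by
  have hi : (Finset.univ.image (fvv m h)).card ≤ m := by
    simpa using Finset.card_image_le (s := Finset.univ) (f := fvv m h)
  exact (Finset.card_insert_le _ _).trans (Nat.succ_le_succ hi)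

/-- The parent of a vertex in the spider with centre `r` and legs `a_n, b_n`. -/
def spiderParent (m h : ℕ) : FV m h → FV m h
  | Sum.inr (Sum.inr (Sum.inr (Sum.inr n))) => fva m h n
  | _ => fvr m h

lemma spiderParent_notMem (m h : ℕ) (v : FV m h) :
    spiderParent m h v ∉ centerAndLeaves m h := by
  rcases v with _ | _ | _ | _ | _ <;> simp [spiderParent, centerAndLeaves]

lemma spiderParent_eq_of_adj {m h : ℕ} {u v : FV m h} (hu : u ∉ centerAndLeaves m h)
    (hv : v ∉ centerAndLeaves m h) (huv : (Fgraph m h).Adj u v) :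
    (u ≠ fvr m h ∧ spiderParent m h u = v) ∨ (v ≠ fvr m h ∧ spiderParent m h v = u) := by
  rcases u with _ | _ | _ | _ | _ <;> rcases v with _ | _ | _ | _ | _ <;>
    simp_all [Fgraph, spiderParent, centerAndLeaves]

lemma isTree_induce_compl_centerAndLeaves (m h : ℕ) :
    ((Fgraph m h).induce ((↑(centerAndLeaves m h) : Set (FV m h))ᶜ)).IsTree := by
  set G := (Fgraph m h).induce ((↑(centerAndLeaves m h) : Set (FV m h))ᶜ) with hG
  let root : ((↑(centerAndLeaves m h) : Set (FV m h))ᶜ : Set (FV m h)) :=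
    ⟨fvr m h, by simp [centerAndLeaves]⟩
  have ha (n : Fin h) (hn) : G.Reachable ⟨fva m h n, hn⟩ root := by
    apply SimpleGraph.Adj.reachable
    simp [hG, root, Fgraph]
  have hreach (u) : G.Reachable u root := by
    obtain ⟨u, hu⟩ := u
    rcases u with _ | _ | t | n | n
    · simp [centerAndLeaves] at hu
    · exact SimpleGraph.Reachable.refl _
    · simp [centerAndLeaves] at hu
    · exact ha n hu
    · refine SimpleGraph.Reachable.trans (SimpleGraph.Adj.reachable ?_)
        (ha n (by simp [centerAndLeaves]))
      simp [hG, Fgraph]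
  have hconn : G.Connected :=
    { preconnected := fun u v => (hreach u).trans (hreach v).symm
      nonempty := ⟨root⟩ }
  refine hconn.isTree_of_parent root
    (fun v => ⟨spiderParent m h v, by simpa using spiderParent_notMem m h v⟩) ?_
  rintro ⟨u, hu⟩ ⟨v, hv⟩ huv
  have := spiderParent_eq_of_adj (u := u) (v := v) (by simpa using hu) (by simpa using hv) huv
  simpa only [ne_eq, Subtype.mk.injEq, root] using this

lemma exists_triangle_of_card_lt {m h : ℕ} {S : Finset (FV m h)} (hS : S.card < h) :
    ∃ n, fva m h n ∉ S ∧ fvb m h n ∉ S := by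
  by_contra! hcon
  have hex (n : Fin h) : ∃ v ∈ S, v = fva m h n ∨ v = fvb m h n := by
    by_cases hn : fva m h n ∈ S
    · exact ⟨_, hn, Or.inl rfl⟩
    · exact ⟨_, hcon n hn, Or.inr rfl⟩
  choose f hfS hf using hex
  have hinj : Function.Injective f := by
    intro n k hnk
    rcases hf n with h1 | h1 <;> rcases hf k with h2 | h2 <;> simp_all
  have := Finset.card_le_card_of_injOn f (s := Finset.univ) (fun n _ => hfS n) hinj.injOn
  simp at this
  omega

lemma eq_center_of_adj_leaf {m h : ℕ} {t : Fin m} {v : FV m h}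
    (hadj : (Fgraph m h).Adj (fvv m h t) v) : v = fvx m h := by
  have : fvv m h t ≠ v ∧ v = fvx m h := by simpa [Fgraph] using hadj
  exact this.2

lemma le_card_of_isTree {m h : ℕ} (hmh : m < h) {S : Finset (FV m h)}
    (hT : ((Fgraph m h).induce ((↑S : Set (FV m h))ᶜ)).IsTree) : m + 1 ≤ S.card := by
  by_contra! hS
  obtain ⟨n, han, hbn⟩ := exists_triangle_of_card_lt (hS.trans_le hmh)
  by_cases hx : fvx m h ∈ S
  · obtain ⟨t, ht⟩ : ∃ t, fvv m h t ∉ S := by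
      by_contra! hv
      have hsub : centerAndLeaves m h ⊆ S := by
        intro v
        simp only [centerAndLeaves, Finset.mem_insert, Finset.mem_image, Finset.mem_univ, true_and]
        rintro (rfl | ⟨t, rfl⟩)
        exacts [hx, hv t]
      have hcard := Finset.card_le_card hsub
      rw [centerAndLeaves, Finset.card_insert_of_notMem (by simp),
        Finset.card_image_of_injective _ (fun _ _ hst => by simpa using hst)] at hcard
      simp at hcard
      omega
    obtain ⟨w⟩ := hT.connected.preconnected ⟨fvv m h t, by simpa using ht⟩
      ⟨fva m h n, by simpa using han⟩
    cases w with
    | @cons _ v _ hadj _ =>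
      have hv : (v : FV m h) = fvx m h := eq_center_of_adj_leaf hadj
      exact v.2 (by simpa [hv] using hx)
  · let G := (Fgraph m h).induce ((↑S : Set (FV m h))ᶜ)
    let x : ((↑S : Set (FV m h))ᶜ : Set (FV m h)) := ⟨fvx m h, by simpa using hx⟩
    let a : ((↑S : Set (FV m h))ᶜ : Set (FV m h)) := ⟨fva m h n, by simpa using han⟩
    let b : ((↑S : Set (FV m h))ᶜ : Set (FV m h)) := ⟨fvb m h n, by simpa using hbn⟩
    have hxa : G.Adj x a := by simp [G, x, a, Fgraph]
    have hab : G.Adj a b := by simp [G, a, b, Fgraph]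
    have hbx : G.Adj b x := by simp [G, b, x, Fgraph]
    refine hT.isAcyclic (.cons hxa (.cons hab (.cons hbx .nil))) ?_
    simp [SimpleGraph.Walk.isCycle_def, SimpleGraph.Walk.isTrail_def, x, a, b]

/-- For `1 ≤ i < j` and `h = j + 1`: `tds(F(i)) ≤ i + 1` and `tds(F(j)) ≥ j + 1`. -/
theorem stmt13 (i j : ℕ) (h1i : 1 ≤ i) (hij : i < j) :
    tdsNum (Fgraph i (j + 1)) ≤ i + 1 ∧ j + 1 ≤ tdsNum (Fgraph j (j + 1)) := by
  refine ⟨?_, ?_⟩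
  · refine (Nat.sInf_le ?_).trans (card_centerAndLeaves_le i (j + 1))
    exact ⟨_, isTree_induce_compl_centerAndLeaves i (j + 1), rfl⟩
  · refine le_csInf ⟨_, _, isTree_induce_compl_centerAndLeaves j (j + 1), rfl⟩ ?_
    rintro _ ⟨S, hT, rfl⟩
    exact le_card_of_isTree (Nat.lt_succ_self j) hT
end

section
/- Let i and j be natural numbers with 2 ≤ i < j and set h = j + 2. For m ∈ ℕ let F'(m) be the graph with vertex set {x, y, r} ∪ {v_1, …, v_m} ∪ {a_1, b_1, …, a_h, b_h} (all distinct) whose edges are: {x, v_t} and {y, v_t} for each t ∈ {1, …, m}, and for each n ∈ {1, …, h} the edges {a_n, b_n}, {x, a_n}, {x, b_n}, and {r, a_n}. Then the tree deletion number satisfies tds(F'(i)) ≤ i + 2 and tds(F'(j)) ≥ j + 2. -/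
/-- Vertex type of the graph `F'(m)` (with `h` pairs `a_n, b_n`): the vertices `x`,
`y`, `r`, `v_1, …, v_m`, `a_1, …, a_h`, `b_1, …, b_h`. -/
abbrev FV' (m h : ℕ) : Type := Unit ⊕ Unit ⊕ Unit ⊕ Fin m ⊕ Fin h ⊕ Fin h

/-- The vertex `x`. -/
abbrev fx' (m h : ℕ) : FV' m h := Sum.inl ()
/-- The vertex `y`. -/
abbrev fy' (m h : ℕ) : FV' m h := Sum.inr (Sum.inl ())
/-- The vertex `r`. -/
abbrev fr' (m h : ℕ) : FV' m h := Sum.inr (Sum.inr (Sum.inl ()))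
/-- The vertex `v_t`. -/
abbrev fv' (m h : ℕ) (t : Fin m) : FV' m h := Sum.inr (Sum.inr (Sum.inr (Sum.inl t)))
/-- The vertex `a_n`. -/
abbrev fa' (m h : ℕ) (n : Fin h) : FV' m h :=
  Sum.inr (Sum.inr (Sum.inr (Sum.inr (Sum.inl n))))
/-- The vertex `b_n`. -/
abbrev fb' (m h : ℕ) (n : Fin h) : FV' m h :=
  Sum.inr (Sum.inr (Sum.inr (Sum.inr (Sum.inr n))))

/-- The graph `F'(m)`: edges `{x, v_t}` and `{y, v_t}` for all `t`, and for each `n`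
the edges `{a_n, b_n}`, `{x, a_n}`, `{x, b_n}`, `{r, a_n}`. -/
def F'graph (m h : ℕ) : SimpleGraph (FV' m h) :=
  SimpleGraph.fromRel (fun u v =>
    (∃ t : Fin m, (u = fx' m h ∧ v = fv' m h t) ∨ (u = fy' m h ∧ v = fv' m h t)) ∨
    (∃ n : Fin h,
      (u = fa' m h n ∧ v = fb' m h n) ∨ (u = fx' m h ∧ v = fa' m h n) ∨
      (u = fx' m h ∧ v = fb' m h n) ∨ (u = fr' m h ∧ v = fa' m h n)))

namespace SimpleGraph

/-- A graph whose edges all join a vertex `v` to `parent v`, with a depth strictly decreasing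
along `parent`, is acyclic. -/
theorem isAcyclic_of_parent {V : Type*} {G : SimpleGraph V} (parent : V → V) (depth : V → ℕ)
    (h : ∀ u v, G.Adj u v →
      (v = parent u ∧ depth v < depth u) ∨ (u = parent v ∧ depth u < depth v)) :
    G.IsAcyclic := by
  classical
  intro u c hc
  obtain ⟨v, hv, hmax⟩ := c.support.toFinset.exists_max_image depth ⟨u, by simp⟩
  simp only [List.mem_toFinset] at hv hmax
  have key : ∀ w, c.toSubgraph.Adj v w → w = parent v := by
    intro w hw
    have hwc := hmax w (c.mem_verts_toSubgraph.1 hw.snd_mem)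
    rcases h v w hw.adj_sub with h | h
    · exact h.1
    · omega
  obtain ⟨w₁, w₂, hne, hN⟩ := Set.ncard_eq_two.1 (hc.ncard_neighborSet_toSubgraph_eq_two hv)
  have h₁ : w₁ ∈ c.toSubgraph.neighborSet v := by simp [hN]
  have h₂ : w₂ ∈ c.toSubgraph.neighborSet v := by simp [hN]
  exact hne ((key w₁ h₁).trans (key w₂ h₂).symm)

/-- A set closed under adjacency that meets a connected graph contains every vertex. -/
theorem Connected.mem_of_forall_adj {V : Type*} {G : SimpleGraph V} (hG : G.Connected) {s : Set V}
    (hs : ∀ u v, G.Adj u v → u ∈ s → v ∈ s) {u : V} (hu : u ∈ s) (v : V) : v ∈ s := by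
  by_contra hv
  obtain ⟨p⟩ := hG.preconnected u v
  obtain ⟨d, -, hd₁, hd₂⟩ := p.exists_boundary_dart s hu hv
  exact hd₂ (hs _ _ d.adj hd₁)

/-- An acyclic graph contains no triangle. -/
theorem IsAcyclic.not_triangle {V : Type*} {G : SimpleGraph V} (hG : G.IsAcyclic) {u v w : V}
    (huv : G.Adj u v) (huw : G.Adj u w) (hvw : G.Adj v w) : False := by
  classical
  exact hG.cliqueFree le_rfl {u, v, w} (is3Clique_triple_iff.2 ⟨huv, huw, hvw⟩)

end SimpleGraph

/-- The set `{x, y, v_1, …, v_m}`. -/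
def starVerts (m h : ℕ) : Finset (FV' m h) :=
  insert (fx' m h) (insert (fy' m h) (Finset.univ.image (fv' m h)))

theorem mem_starVerts {m h : ℕ} {w : FV' m h} :
    w ∈ starVerts m h ↔ w = fx' m h ∨ w = fy' m h ∨ ∃ t, fv' m h t = w := by
  simp [starVerts]

theorem card_starVerts (m h : ℕ) : (starVerts m h).card = m + 2 := by
  have hinj : Function.Injective (fv' m h) := fun _ _ hst => by simpa using hst
  simp [starVerts, Finset.card_image_of_injective _ hinj]

/-- Removing `{x, y, v_1, …, v_m}` leaves a tree rooted at `r`. -/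
theorem isTree_induce_compl_starVerts (m h : ℕ) :
    ((F'graph m h).induce ((starVerts m h : Set (FV' m h))ᶜ)).IsTree := by
  have hr : fr' m h ∈ ((starVerts m h : Set (FV' m h))ᶜ) := by simp [mem_starVerts]
  have ha : ∀ n, fa' m h n ∈ ((starVerts m h : Set (FV' m h))ᶜ) := by simp [mem_starVerts]
  have hra : ∀ n, ((F'graph m h).induce ((starVerts m h : Set (FV' m h))ᶜ)).Adj
      ⟨_, hr⟩ ⟨_, ha n⟩ := by simp [F'graph]
  refine ⟨?_, ?_⟩
  · rw [SimpleGraph.connected_iff_exists_forall_reachable]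
    refine ⟨⟨_, hr⟩, ?_⟩
    rintro ⟨⟨⟩ | ⟨⟩ | ⟨⟩ | t | n | n, hw⟩
    · simp [mem_starVerts] at hw
    · simp [mem_starVerts] at hw
    · exact SimpleGraph.Reachable.refl _
    · simp [mem_starVerts] at hw
    · exact (hra n).reachable
    · refine (hra n).reachable.trans (SimpleGraph.Adj.reachable ?_)
      simp [F'graph]
  · refine SimpleGraph.isAcyclic_of_parent
      (fun w => match w with
        | ⟨Sum.inr (Sum.inr (Sum.inr (Sum.inr (Sum.inr n)))), _⟩ => ⟨_, ha n⟩
        | _ => ⟨_, hr⟩)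
      (fun w => match w with
        | ⟨Sum.inr (Sum.inr (Sum.inr (Sum.inr (Sum.inr _)))), _⟩ => 2
        | ⟨Sum.inr (Sum.inr (Sum.inr (Sum.inr (Sum.inl _)))), _⟩ => 1
        | _ => 0) ?_
    rintro ⟨⟨⟩ | ⟨⟩ | ⟨⟩ | t | n | n, hw⟩ ⟨⟨⟩ | ⟨⟩ | ⟨⟩ | t' | n' | n', hw'⟩ hadj <;>
      first
      | (refine absurd hw ?_; simp [mem_starVerts]; done)
      | (refine absurd hw' ?_; simp [mem_starVerts]; done)
      | simp_all [F'graph]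

/-- Any vertex set whose removal from `F'(m)` leaves a tree has at least `min h (m + 2)`
elements. -/
theorem min_le_card_of_isTree_induce_compl {m h : ℕ} {S : Finset (FV' m h)}
    (hS : ((F'graph m h).induce ((S : Set (FV' m h))ᶜ)).IsTree) :
    min h (m + 2) ≤ S.card := by
  classical
  by_cases hall : ∀ n, fa' m h n ∈ S ∨ fb' m h n ∈ S
  · refine (min_le_left _ _).trans ?_
    let f : Fin h → FV' m h := fun n => if fa' m h n ∈ S then fa' m h n else fb' m h n
    have hf : Function.Injective f := by
      intro n n' hnn'
      simp only [f] at hnn'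
      split_ifs at hnn' <;> simp_all
    have hsub : Finset.univ.map ⟨f, hf⟩ ⊆ S := by
      intro w hw
      obtain ⟨n, -, rfl⟩ := Finset.mem_map.1 hw
      have := hall n
      simp only [Function.Embedding.coeFn_mk, f]
      split_ifs <;> tauto
    simpa using Finset.card_le_card hsub
  · push Not at hall
    obtain ⟨n, han, hbn⟩ := hall
    refine (min_le_right _ _).trans ?_
    have hx : fx' m h ∈ S := by
      by_contra hx
      refine hS.isAcyclic.not_triangle (u := ⟨fx' m h, hx⟩) (v := ⟨fa' m h n, han⟩)
        (w := ⟨fb' m h n, hbn⟩) ?_ ?_ ?_ <;> simp [F'graph]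
    have hmem := hS.connected.mem_of_forall_adj
      (s := {w | w.1 ∉ starVerts m h}) (u := ⟨fa' m h n, han⟩) (by
        rintro ⟨⟨⟩ | ⟨⟩ | ⟨⟩ | t | n | n, hw⟩ ⟨⟨⟩ | ⟨⟩ | ⟨⟩ | t' | n' | n', hw'⟩ hadj <;>
          first
          | exact absurd hx hw'
          | simp_all [mem_starVerts, F'graph])
      (by simp [mem_starVerts])
    rw [← card_starVerts m h]
    refine Finset.card_le_card fun w hw => ?_
    by_contra hwS
    exact hmem ⟨w, hwS⟩ hw

/-- For `2 ≤ i < j` and `h = j + 2`: `tds(F'(i)) ≤ i + 2` and `tds(F'(j)) ≥ j + 2`. -/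
theorem stmt14 (i j : ℕ) (h2i : 2 ≤ i) (hij : i < j) :
    tdsNum (F'graph i (j + 2)) ≤ i + 2 ∧ j + 2 ≤ tdsNum (F'graph j (j + 2)) := by
  refine ⟨Nat.sInf_le ⟨_, isTree_induce_compl_starVerts _ _, card_starVerts _ _⟩, ?_⟩
  refine le_csInf ⟨_, _, isTree_induce_compl_starVerts _ _, rfl⟩ ?_
  rintro _ ⟨S, hS, rfl⟩
  simpa using min_le_card_of_isTree_induce_compl hS
end

section
/- Fix B = {x₁, x₂, x₃, x₄}, and for each i ∈ ℕ let G^i be the graph with vertex set B ∪ {a, b_1, …, b_{i+1}} (all distinct) whose edges are: {x₁, a}, {a, x₂}, {x₃, b_1}, {b_n, b_{n+1}} for n = 1, …, i, and {b_{i+1}, x₄}; note every vertex of G^i outside B has degree 2. Then for all distinct i, j ∈ ℕ, the boundaried graphs G^i_B and G^j_B are not gluing equivalent with respect to the longest-cycle length: there is no integer Δ such that lc(G^i_B ⊕ H_B) = lc(G^j_B ⊕ H_B) + Δ for every boundaried graph H_B with V(H) ∩ V(G^i) ⊆ B and V(H) ∩ V(G^j) ⊆ B. In particular, Long Cycle does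 not have finite integer index, even on the class of B-boundaried graphs in which every vertex outside B has degree 2. -/
/-- The number of edges of a longest cycle of a boundaried graph (`0` if there is no
cycle). -/
noncomputable def lcNumB {V : Type*} (A : BGraph V) : ℕ :=
  sSup {n | ∃ (v : V) (p : A.graph.Walk v v), p.IsCycle ∧ p.length = n}

/-- The one-directional edge relation of the graph `G^i` from the Long Cycle lower
bound: a path `x₁ – a – x₂` and a path `x₃ – b 0 – b 1 – ⋯ – b i – x₄`. -/
def lcRel {V : Type*} (x1 x2 x3 x4 a : V) (b : ℕ → V) (i : ℕ) : V → V → Prop :=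
  fun u v =>
    (u = x1 ∧ v = a) ∨ (u = a ∧ v = x2) ∨ (u = x3 ∧ v = b 0) ∨
    (∃ n, n < i ∧ u = b n ∧ v = b (n + 1)) ∨ (u = b i ∧ v = x4)

open SimpleGraph in
/-- A vertex with at most one neighbour on a cycle does not lie on that cycle. -/
theorem SimpleGraph.Walk.IsCycle.notMem_support_of_adj_eq {V : Type*} [DecidableEq V]
    {G : SimpleGraph V} {v : V} {p : G.Walk v v} (hp : p.IsCycle) {u w : V}
    (h : ∀ y ∈ p.support, G.Adj u y → y = w) : u ∉ p.support := by
  intro hu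
  have hq := hp.rotate hu
  have hs : ∀ y ∈ (p.rotate u hu).support, G.Adj u y → y = w := fun y hy =>
    h y ((Walk.mem_support_rotate_iff p u hu).1 hy)
  apply hq.snd_ne_penultimate
  exact (hs _ (Walk.getVert_mem_support _ _) (Walk.adj_snd hq.not_nil)).trans
    (hs _ (Walk.getVert_mem_support _ _) (Walk.adj_penultimate hq.not_nil).symm).symm

theorem SimpleGraph.Walk.IsCycle.exists_adj_of_mem_support {V : Type*} [DecidableEq V]
    {G : SimpleGraph V} {v : V} {p : G.Walk v v} (hp : p.IsCycle) {u : V} (hu : u ∈ p.support) :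
    ∃ y ∈ p.support, G.Adj u y := by
  by_contra! h
  exact hp.notMem_support_of_adj_eq (w := u) (fun y hy hy' => absurd hy' (h y hy)) hu

open SimpleGraph in
theorem SimpleGraph.Walk.IsCycle.length_le_card {V : Type*} [DecidableEq V]
    {G : SimpleGraph V} {v : V} {p : G.Walk v v} (hp : p.IsCycle) {S : Finset V}
    (h : ∀ y ∈ p.support, y ∈ S) : p.length ≤ S.card := by
  have h1 : p.support.tail.toFinset.card = p.length := by
    rw [List.toFinset_card_of_nodup hp.support_nodup]
    simp
  rw [← h1]
  refine Finset.card_le_card fun y hy => h y ?_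
  exact List.mem_of_mem_tail (List.mem_toFinset.1 hy)

open SimpleGraph in
theorem SimpleGraph.exists_isPath_of_injOn {V : Type*} {G : SimpleGraph V} (f : ℕ → V) (m : ℕ)
    (hadj : ∀ k < m, G.Adj (f k) (f (k + 1))) (hinj : Set.InjOn f (Set.Iic m)) :
    ∃ p : G.Walk (f 0) (f m), p.IsPath ∧ p.length = m ∧
      (∀ y ∈ p.support, ∃ k ≤ m, y = f k) ∧
      ∀ e ∈ p.edges, ∃ k < m, e = s(f k, f (k + 1)) := by
  induction m with
  | zero => exact ⟨Walk.nil, by simp⟩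
  | succ m ih =>
    obtain ⟨p, hp, hl, hs, he⟩ := ih (fun k hk => hadj k (by omega))
      (hinj.mono (Set.Iic_subset_Iic.2 (by omega)))
    refine ⟨p.concat (hadj m (by omega)), hp.concat ?_ _, by simp [hl], ?_, ?_⟩
    · intro hmem
      obtain ⟨k, hk, hk'⟩ := hs _ hmem
      have := hinj (Set.mem_Iic.2 le_rfl) (Set.mem_Iic.2 (by omega)) hk'
      omega
    · intro y hy
      simp only [Walk.support_concat, List.mem_append, List.mem_singleton] at hy
      rcases hy with hy | rfl
      · obtain ⟨k, hk, rfl⟩ := hs y hy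
        exact ⟨k, by omega, rfl⟩
      · exact ⟨m + 1, le_rfl, rfl⟩
    · intro e hmem
      simp only [Walk.edges_concat, List.concat_eq_append, List.mem_append,
        List.mem_singleton] at hmem
      rcases hmem with hmem | rfl
      · obtain ⟨k, hk, rfl⟩ := he e hmem
        exact ⟨k, by omega, rfl⟩
      · exact ⟨m, by omega, rfl⟩

open SimpleGraph in
theorem SimpleGraph.exists_isCycle_of_injOn {V : Type*} {G : SimpleGraph V} (f : ℕ → V) (m : ℕ)
    (hm : 2 ≤ m) (hadj : ∀ k < m, G.Adj (f k) (f (k + 1))) (hinj : Set.InjOn f (Set.Iic m))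
    (hlast : G.Adj (f m) (f 0)) :
    ∃ (v : V) (p : G.Walk v v), p.IsCycle ∧ p.length = m + 1 := by
  obtain ⟨p, hp, hl, -, he⟩ := exists_isPath_of_injOn f m hadj hinj
  refine ⟨_, Walk.cons hlast p, (Walk.cons_isCycle_iff _ _).2 ⟨hp, fun hmem => ?_⟩, by simp [hl]⟩
  obtain ⟨k, hk, hek⟩ := he _ hmem
  have inj : ∀ s t, s ≤ m → t ≤ m → f s = f t → s = t := fun s t hs ht h =>
    hinj (Set.mem_Iic.2 hs) (Set.mem_Iic.2 ht) h
  rcases Sym2.eq_iff.1 hek with ⟨h1, -⟩ | ⟨h1, h2⟩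
  · have := inj _ _ le_rfl hk.le h1
    omega
  · have := inj _ _ le_rfl (by omega) h1
    have := inj _ _ (by omega) hk.le h2
    omega

/-- The edgeless boundaried graph on a finite vertex set. -/
def BGraph.empty {V : Type*} (S : Finset V) : BGraph V where
  verts := S
  graph := ⊥
  support := by simp

/-- The boundaried graph on a finite vertex set with a single edge. -/
def BGraph.singleEdge {V : Type*} (S : Finset V) {x y : V} (hx : x ∈ S) (hy : y ∈ S) :
    BGraph V where
  verts := S
  graph := SimpleGraph.edge x y
  support := by
    intro u v h
    rw [SimpleGraph.edge_adj] at h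
    rcases h.1 with ⟨rfl, rfl⟩ | ⟨rfl, rfl⟩ <;> exact ⟨by assumption, by assumption⟩

/-- The labels `x₁, x₂, x₃, x₄, a, b 0, …, b i` are pairwise distinct. -/
structure LcDistinct {V : Type*} (x1 x2 x3 x4 a : V) (b : ℕ → V) (i : ℕ) : Prop where
  nodup : [x1, x2, x3, x4, a].Nodup
  notMem : ∀ n ≤ i, b n ∉ [x1, x2, x3, x4, a]
  inj : ∀ m ≤ i, ∀ n ≤ i, b m = b n → m = n

section
variable {V : Type*} [DecidableEq V] {x1 x2 x3 x4 a : V} {b : ℕ → V} {i : ℕ} {G : BGraph V}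

theorem LcDistinct.of_card
    (hB : ({x1, x2, x3, x4} : Finset V).card = 4)
    (ha : a ∉ ({x1, x2, x3, x4} : Finset V))
    (hb : ∀ n ≤ i, b n ∉ ({x1, x2, x3, x4, a} : Finset V))
    (hinj : ∀ m ≤ i, ∀ n ≤ i, b m = b n → m = n) : LcDistinct x1 x2 x3 x4 a b i where
  nodup := by
    have h : [x1, x2, x3, x4].Nodup := by
      rw [← Multiset.coe_nodup, ← Multiset.toFinset_card_eq_card_iff_nodup]
      simpa using hB
    simp only [Finset.mem_insert, Finset.mem_singleton] at ha
    simp only [List.nodup_cons, List.mem_cons] at h ⊢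
    grind
  notMem n hn := by simpa using hb n hn
  inj := hinj

/-- No cycle passes through `x₁`, `x₂` or `a` if only the edge `x₃x₄` is added. -/
theorem LcDistinct.notMem_support (hd : LcDistinct x1 x2 x3 x4 a b i) {K : SimpleGraph V}
    (hK : ∀ u v, K.Adj u v → lcRel x1 x2 x3 x4 a b i u v ∨ lcRel x1 x2 x3 x4 a b i v u ∨
      (u = x3 ∧ v = x4) ∨ (u = x4 ∧ v = x3))
    {v : V} {p : K.Walk v v} (hp : p.IsCycle) :
    x1 ∉ p.support ∧ x2 ∉ p.support ∧ a ∉ p.support := by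
  obtain ⟨hn, hb, -⟩ := hd
  simp only [lcRel] at hK
  simp only [List.nodup_cons, List.mem_cons, List.not_mem_nil] at hn hb
  have h1 : x1 ∉ p.support := hp.notMem_support_of_adj_eq (w := a) fun y _ hy => by
    have := hK _ _ hy
    grind
  have h2 : x2 ∉ p.support := hp.notMem_support_of_adj_eq (w := a) fun y _ hy => by
    have := hK _ _ hy
    grind
  refine ⟨h1, h2, hp.notMem_support_of_adj_eq (w := x1) fun y hy hy' => ?_⟩
  have := hK _ _ hy'
  grind

theorem LcDistinct.not_isCycle (hd : LcDistinct x1 x2 x3 x4 a b i) {K : SimpleGraph V}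
    (hK : ∀ u v, K.Adj u v → lcRel x1 x2 x3 x4 a b i u v ∨ lcRel x1 x2 x3 x4 a b i v u)
    {v : V} (p : K.Walk v v) : ¬ p.IsCycle := by
  intro hp
  obtain ⟨h1, h2, ha⟩ := hd.notMem_support
    (fun u v h => (hK u v h).elim Or.inl fun h => Or.inr (Or.inl h)) hp
  obtain ⟨hn, hb, hinj⟩ := hd
  simp only [lcRel] at hK
  simp only [List.nodup_cons, List.mem_cons, List.not_mem_nil] at hn hb
  have h3 : x3 ∉ p.support := hp.notMem_support_of_adj_eq (w := b 0) fun y _ hy => by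
    have := hK _ _ hy
    grind
  have h4 : x4 ∉ p.support := hp.notMem_support_of_adj_eq (w := b i) fun y _ hy => by
    have := hK _ _ hy
    grind
  have hbs : ∀ n ≤ i, b n ∉ p.support := by
    intro n
    induction n with
    | zero =>
      refine fun hn0 => hp.notMem_support_of_adj_eq (w := b 1) fun y hy hy' => ?_
      have := hK _ _ hy'
      grind
    | succ n ih =>
      refine fun hn0 => hp.notMem_support_of_adj_eq (w := b (n + 2)) fun y hy hy' => ?_
      have := hK _ _ hy'
      grind
  obtain ⟨y, -, hy⟩ := hp.exists_adj_of_mem_support p.start_mem_support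
  have := hK _ _ hy
  have := p.start_mem_support
  grind

theorem LcDistinct.lcNumB_glue_empty (hd : LcDistinct x1 x2 x3 x4 a b i)
    (hG : ∀ u v, G.graph.Adj u v ↔
      u ≠ v ∧ (lcRel x1 x2 x3 x4 a b i u v ∨ lcRel x1 x2 x3 x4 a b i v u)) (S : Finset V) :
    lcNumB (G.glue (BGraph.empty S)) = 0 := by
  have hK : ∀ u v, (G.glue (BGraph.empty S)).graph.Adj u v →
      lcRel x1 x2 x3 x4 a b i u v ∨ lcRel x1 x2 x3 x4 a b i v u := by
    intro u v h
    simp only [BGraph.glue, BGraph.empty, sup_bot_eq] at h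
    exact ((hG u v).1 h).2
  have : {n | ∃ (v : V) (p : (G.glue (BGraph.empty S)).graph.Walk v v),
      p.IsCycle ∧ p.length = n} = ∅ := by
    ext n
    simp only [Set.mem_ofPred_eq, Set.mem_empty_iff_false, iff_false]
    rintro ⟨v, p, hp, -⟩
    exact hd.not_isCycle hK p hp
  rw [lcNumB, this, csSup_empty]
  rfl

theorem LcDistinct.lcNumB_glue_singleEdge (hd : LcDistinct x1 x2 x3 x4 a b i)
    (hG : ∀ u v, G.graph.Adj u v ↔
      u ≠ v ∧ (lcRel x1 x2 x3 x4 a b i u v ∨ lcRel x1 x2 x3 x4 a b i v u))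
    {S : Finset V} (h3 : x3 ∈ S) (h4 : x4 ∈ S) :
    lcNumB (G.glue (BGraph.singleEdge S h3 h4)) = i + 3 := by
  have hadj : ∀ u v, (G.glue (BGraph.singleEdge S h3 h4)).graph.Adj u v ↔
      u ≠ v ∧ (lcRel x1 x2 x3 x4 a b i u v ∨ lcRel x1 x2 x3 x4 a b i v u ∨
        (u = x3 ∧ v = x4) ∨ (u = x4 ∧ v = x3)) := by
    intro u v
    simp only [BGraph.glue, BGraph.singleEdge, SimpleGraph.sup_adj, hG, SimpleGraph.edge_adj]
    tauto
  refine IsGreatest.csSup_eq ⟨?_, ?_⟩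
  · obtain ⟨hn, hb, hinj⟩ := hd
    simp only [List.nodup_cons, List.mem_cons, List.not_mem_nil] at hn hb
    let f : ℕ → V := fun k => if k = 0 then x3 else if k = i + 2 then x4 else b (k - 1)
    have f0 : f 0 = x3 := rfl
    have fl : f (i + 2) = x4 := by simp [f]
    have fs : ∀ n ≤ i, f (n + 1) = b n := fun n hn => by
      simp only [f]
      grind
    refine SimpleGraph.exists_isCycle_of_injOn f (i + 2) (by omega) ?_ ?_ ?_
    · intro k hk
      rw [hadj]
      simp only [lcRel]
      rcases k with _ | k
      · rw [f0, fs 0 (by omega)]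
        grind
      · rw [fs k (by omega)]
        rcases (show k < i ∨ k = i by omega) with hk | rfl
        · rw [fs (k + 1) (by omega)]
          grind
        · rw [fl]
          grind
    · intro s hs t ht hst
      simp only [Set.mem_Iic] at hs ht
      simp only [f] at hst
      grind
    · rw [hadj, f0, fl]
      grind
  · rintro n ⟨v, p, hp, rfl⟩
    obtain ⟨h1, h2, ha⟩ := hd.notMem_support (fun u v h => ((hadj u v).1 h).2) hp
    have hsub : ∀ y ∈ p.support, y ∈ {x3, x4} ∪ (Finset.range (i + 1)).image b := by
      intro y hy
      obtain ⟨z, -, hyz⟩ := hp.exists_adj_of_mem_support hy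
      have := ((hadj y z).1 hyz).2
      simp only [lcRel] at this
      simp only [Finset.mem_union, Finset.mem_insert, Finset.mem_singleton, Finset.mem_image,
        Finset.mem_range]
      grind
    calc p.length ≤ _ := hp.length_le_card hsub
      _ ≤ ({x3, x4} : Finset V).card + ((Finset.range (i + 1)).image b).card :=
        Finset.card_union_le _ _
      _ ≤ 2 + (i + 1) := add_le_add Finset.card_le_two
        (Finset.card_image_le.trans (Finset.card_range _).le)
      _ = i + 3 := by omega

end

/-- Long Cycle does not have finite integer index, even on boundaried graphs in which
every non-boundary vertex has degree `2`: with boundary `B = {x₁, x₂, x₃, x₄}`, the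
graphs `G^i` (a path `x₁–a–x₂` of length 2 plus a path `x₃–b₁–⋯–b_{i+1}–x₄` of length
`i+2`, all internal vertices distinct and outside `B`) are pairwise not gluing
equivalent with respect to the longest-cycle length. -/
theorem stmt15 {V : Type*} [DecidableEq V] [Infinite V]
    (x1 x2 x3 x4 : V) (hB : ({x1, x2, x3, x4} : Finset V).card = 4)
    (i j : ℕ) (hij : i ≠ j)
    (ai aj : V) (bi bj : ℕ → V)
    (hai : ai ∉ ({x1, x2, x3, x4} : Finset V))
    (haj : aj ∉ ({x1, x2, x3, x4} : Finset V))
    (hbi : ∀ n ≤ i, bi n ∉ ({x1, x2, x3, x4, ai} : Finset V))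
    (hbj : ∀ n ≤ j, bj n ∉ ({x1, x2, x3, x4, aj} : Finset V))
    (hbiInj : ∀ m ≤ i, ∀ n ≤ i, bi m = bi n → m = n)
    (hbjInj : ∀ m ≤ j, ∀ n ≤ j, bj m = bj n → m = n)
    (Gi Gj : BGraph V)
    (hvi : Gi.verts = {x1, x2, x3, x4, ai} ∪ (Finset.range (i + 1)).image bi)
    (hvj : Gj.verts = {x1, x2, x3, x4, aj} ∪ (Finset.range (j + 1)).image bj)
    (hGi : ∀ u v, Gi.graph.Adj u v ↔
      u ≠ v ∧ (lcRel x1 x2 x3 x4 ai bi i u v ∨ lcRel x1 x2 x3 x4 ai bi i v u))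
    (hGj : ∀ u v, Gj.graph.Adj u v ↔
      u ≠ v ∧ (lcRel x1 x2 x3 x4 aj bj j u v ∨ lcRel x1 x2 x3 x4 aj bj j v u)) :
    ¬ ∃ Δ : ℤ, ∀ H : BGraph V, ({x1, x2, x3, x4} : Finset V) ⊆ H.verts →
      H.verts ∩ Gi.verts ⊆ {x1, x2, x3, x4} → H.verts ∩ Gj.verts ⊆ {x1, x2, x3, x4} →
      (lcNumB (Gi.glue H) : ℤ) = lcNumB (Gj.glue H) + Δ := by
  rintro ⟨Δ, hΔ⟩
  have hdi := LcDistinct.of_card hB hai hbi hbiInj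
  have hdj := LcDistinct.of_card hB haj hbj hbjInj
  have h0 := hΔ (BGraph.empty {x1, x2, x3, x4}) subset_rfl Finset.inter_subset_left
    Finset.inter_subset_left
  have h1 := hΔ (BGraph.singleEdge (x := x3) (y := x4) {x1, x2, x3, x4} (by simp) (by simp))
    subset_rfl Finset.inter_subset_left Finset.inter_subset_left
  rw [hdi.lcNumB_glue_empty hGi, hdj.lcNumB_glue_empty hGj] at h0
  rw [hdi.lcNumB_glue_singleEdge hGi, hdj.lcNumB_glue_singleEdge hGj] at h1
  omega
end

section
/- Fix B = {x₁, x₂, x₃}, and for each i ∈ ℕ let G^i be the graph with vertex set B ∪ {b_1, …, b_{i+1}} (all distinct) whose edges are: {x₂, b_1}, {b_n, b_{n+1}} for n = 1, …, i, and {b_{i+1}, x₃}; note every vertex of G^i outside B has degree 2. Then for all distinct i, j ∈ ℕ, the boundaried graphs G^i_B and G^j_B are not gluing equivalent with respect to the longest-path length: there is no integer Δ such that lp(G^i_B ⊕ H_B) = lp(G^j_B ⊕ H_B) + Δ for every boundaried graph H_B with V(H) ∩ V(G^i) ⊆ B and V(H) ∩ V(G^j) ⊆ B. In particular, Long Path does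 not have finite integer index, even on the class of B-boundaried graphs in which every vertex outside B has degree 2. -/
/-- The number of edges of a longest path of a boundaried graph. -/
noncomputable def lpNumB {V : Type*} (A : BGraph V) : ℕ :=
  sSup {n | ∃ (u v : V) (p : A.graph.Walk u v), p.IsPath ∧ p.length = n}

/-- The one-directional edge relation of the graph `G^i` from the Long Path lower
bound: a path `x₂ – b 0 – b 1 – ⋯ – b i – x₃`. -/
def lpRel {V : Type*} (x2 x3 : V) (b : ℕ → V) (i : ℕ) : V → V → Prop :=
  fun u v =>
    (u = x2 ∧ v = b 0) ∨ (∃ n, n < i ∧ u = b n ∧ v = b (n + 1)) ∨ (u = b i ∧ v = x3)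

/-- A sequence of successively adjacent, pairwise distinct vertices yields a path. -/
theorem SimpleGraph.exists_isPath_of_adj_succ {V : Type*} (G : SimpleGraph V) (c : ℕ → V) (N : ℕ)
    (hadj : ∀ n < N, G.Adj (c n) (c (n + 1)))
    (hinj : ∀ m ≤ N, ∀ n ≤ N, c m = c n → m = n) :
    ∃ p : G.Walk (c 0) (c N), p.IsPath ∧ p.length = N ∧ ∀ v ∈ p.support, ∃ m ≤ N, v = c m := by
  induction N with
  | zero => exact ⟨.nil, by simp, rfl, by simp⟩
  | succ N ih =>
    obtain ⟨p, hp, hl, hs⟩ := ih (fun n hn => hadj n (by lia))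
      (fun m hm n hn => hinj m (by lia) n (by lia))
    refine ⟨p.concat (hadj N (by lia)), hp.concat ?_ _, by simp [hl], ?_⟩
    · intro h
      obtain ⟨m, hm, he⟩ := hs _ h
      have := hinj (N + 1) le_rfl m (by lia) he
      lia
    · intro v hv
      rw [SimpleGraph.Walk.support_concat] at hv
      obtain hv | rfl : v ∈ p.support ∨ v = c (N + 1) := by simpa using hv
      · obtain ⟨m, hm, he⟩ := hs v hv
        exact ⟨m, by lia, he⟩
      · exact ⟨N + 1, le_rfl, rfl⟩

/-- A walk starting in a set closed under adjacency stays in that set. -/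
theorem SimpleGraph.Walk.support_subset_of_adj_closed {V : Type*} {G : SimpleGraph V} {S : Set V}
    (hS : ∀ ⦃u v⦄, G.Adj u v → u ∈ S → v ∈ S) {u v : V} (p : G.Walk u v) (hu : u ∈ S) :
    ∀ w ∈ p.support, w ∈ S := by
  induction p with
  | nil => simpa using hu
  | cons h p ih =>
    intro w hw
    rw [SimpleGraph.Walk.support_cons, List.mem_cons] at hw
    rcases hw with rfl | hw
    · exact hu
    · exact ih (hS h hu) w hw

/-- A path starting in a finite set closed under adjacency is shorter than the size of the set. -/
theorem SimpleGraph.Walk.IsPath.length_lt_card_of_adj_closed {V : Type*} [DecidableEq V]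
    {G : SimpleGraph V}
    {S : Finset V} (hS : ∀ ⦃u v⦄, G.Adj u v → u ∈ S → v ∈ S) {u v : V} {p : G.Walk u v}
    (hp : p.IsPath) (hu : u ∈ S) : p.length < S.card := by
  have h := p.support_subset_of_adj_closed (S := (S : Set V)) (by simpa using hS) (by simpa using hu)
  have h1 : p.support.toFinset.card = p.length + 1 := by
    rw [List.toFinset_card_of_nodup hp.support_nodup, SimpleGraph.Walk.length_support]
  have h2 : p.support.toFinset ⊆ S := fun w hw => by simpa using h w (by simpa using hw)
  have := Finset.card_le_card h2
  lia

theorem lpNumB_eq_of_isGreatest {V : Type*} {A : BGraph V} {M : ℕ}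
    (hex : ∃ (u v : V) (p : A.graph.Walk u v), p.IsPath ∧ p.length = M)
    (hle : ∀ (u v : V) (p : A.graph.Walk u v), p.IsPath → p.length ≤ M) : lpNumB A = M :=
  IsGreatest.csSup_eq ⟨hex, by rintro n ⟨u, v, p, hp, rfl⟩; exact hle u v p hp⟩

/-- The path `f 0 – f 1 – ⋯ – f N`, together with the isolated vertices in `B`. -/
def BGraph.pathWith {V : Type*} [DecidableEq V] (B : Finset V) (f : ℕ → V) (N : ℕ) : BGraph V where
  verts := B ∪ (Finset.range (N + 1)).image f
  graph := SimpleGraph.fromRel fun u v => ∃ n < N, u = f n ∧ v = f (n + 1)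
  support := by
    have key : ∀ n ≤ N, f n ∈ B ∪ (Finset.range (N + 1)).image f := fun n hn =>
      Finset.mem_union_right _ (Finset.mem_image_of_mem f (by simpa using Nat.lt_succ_of_le hn))
    rintro u v ⟨-, ⟨n, hn, rfl, rfl⟩ | ⟨n, hn, rfl, rfl⟩⟩
    · exact ⟨key _ hn.le, key _ hn⟩
    · exact ⟨key _ hn, key _ hn.le⟩

/-- Gluing a disjoint path of length `N` to a path of length `i + 2` makes the longest path have
length `max (i + 2) N`. -/
theorem lpNumB_glue_pathWith {V : Type*} [DecidableEq V] {x2 x3 : V} (h23 : x2 ≠ x3)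
    {i : ℕ} {b : ℕ → V} (hb2 : ∀ n ≤ i, b n ≠ x2) (hb3 : ∀ n ≤ i, b n ≠ x3)
    (hinj : ∀ m ≤ i, ∀ n ≤ i, b m = b n → m = n) {G : BGraph V}
    (hG : ∀ u v, G.graph.Adj u v ↔ u ≠ v ∧ (lpRel x2 x3 b i u v ∨ lpRel x2 x3 b i v u))
    (B : Finset V) {f : ℕ → V} (hf : Function.Injective f) (hf2 : ∀ n, f n ≠ x2)
    (hf3 : ∀ n, f n ≠ x3) (hfb : ∀ n, ∀ m ≤ i, f n ≠ b m) (N : ℕ) :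
    lpNumB (G.glue (.pathWith B f N)) = max (i + 2) N := by
  set S : Finset V := insert x2 (insert x3 ((Finset.range (i + 1)).image b)) with hSdef
  set T : Finset V := (Finset.range (N + 1)).image f with hTdef
  have memS : ∀ v, v ∈ S ↔ v = x2 ∨ v = x3 ∨ ∃ n ≤ i, b n = v := by
    simp [hSdef]
  have memT : ∀ v, v ∈ T ↔ ∃ n ≤ N, f n = v := by simp [hTdef]
  have hdisj : ∀ v ∈ S, v ∉ T := by
    intro v hv hv'
    obtain ⟨n, -, rfl⟩ := (memT v).1 hv'
    rcases (memS _).1 hv with h | h | ⟨m, hm, h⟩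
    exacts [hf2 _ h, hf3 _ h, hfb _ _ hm h.symm]
  have hSc : S.card ≤ i + 3 := by
    have h1 := Finset.card_insert_le x2 (insert x3 ((Finset.range (i + 1)).image b))
    have h2 := Finset.card_insert_le x3 ((Finset.range (i + 1)).image b)
    have h3 : ((Finset.range (i + 1)).image b).card ≤ i + 1 := by
      simpa using Finset.card_image_le (s := Finset.range (i + 1)) (f := b)
    lia
  have hTc : T.card ≤ N + 1 := by
    simpa using Finset.card_image_le (s := Finset.range (N + 1)) (f := f)
  have hrel : ∀ u v, lpRel x2 x3 b i u v → u ∈ S ∧ v ∈ S := by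
    rintro u v (⟨rfl, rfl⟩ | ⟨n, hn, rfl, rfl⟩ | ⟨rfl, rfl⟩) <;> rw [memS, memS]
    · exact ⟨.inl rfl, .inr (.inr ⟨0, by lia, rfl⟩)⟩
    · exact ⟨.inr (.inr ⟨n, hn.le, rfl⟩), .inr (.inr ⟨n + 1, hn, rfl⟩)⟩
    · exact ⟨.inr (.inr ⟨i, le_rfl, rfl⟩), .inr (.inl rfl)⟩
  have hadj : ∀ u v, (G.glue (.pathWith B f N)).graph.Adj u v →
      (u ∈ S ∧ v ∈ S) ∨ (u ∈ T ∧ v ∈ T) := by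
    rintro u v (h | ⟨-, ⟨n, hn, rfl, rfl⟩ | ⟨n, hn, rfl, rfl⟩⟩)
    · obtain ⟨-, h | h⟩ := (hG u v).1 h
      · exact .inl (hrel _ _ h)
      · exact .inl (hrel _ _ h).symm
    · exact .inr ⟨(memT _).2 ⟨n, hn.le, rfl⟩, (memT _).2 ⟨n + 1, hn, rfl⟩⟩
    · exact .inr ⟨(memT _).2 ⟨n + 1, hn, rfl⟩, (memT _).2 ⟨n, hn.le, rfl⟩⟩
  apply lpNumB_eq_of_isGreatest
  · rcases le_total N (i + 2) with h | h
    · rw [max_eq_left h]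
      obtain ⟨p, hp, hl, -⟩ := (G.glue (.pathWith B f N)).graph.exists_isPath_of_adj_succ
        (fun n => if n = 0 then x2 else if n ≤ i + 1 then b (n - 1) else x3) (i + 2)
        (by
          intro n hn
          refine Or.inl ((hG _ _).2 ?_)
          rcases Nat.eq_zero_or_pos n with rfl | hn0
          · simpa [lpRel] using (hb2 0 (by lia)).symm
          · obtain ⟨k, rfl⟩ : ∃ k, n = k + 1 := ⟨n - 1, by lia⟩
            rcases Nat.lt_or_ge k i with hk | hk
            · have e1 : k + 1 ≤ i + 1 := by lia
              have e2 : k + 1 + 1 ≤ i + 1 := by lia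
              simp only [Nat.add_eq_zero_iff, one_ne_zero, and_false, if_false, e1, e2, if_true,
                Nat.add_sub_cancel]
              refine ⟨fun h => ?_, .inl (.inr (.inl ⟨k, hk, rfl, rfl⟩))⟩
              have := hinj _ (by lia) _ (by lia) h
              lia
            · obtain rfl : k = i := by lia
              simpa [lpRel] using hb3 k le_rfl)
        (by
          intro m hm n hn h
          have hb2' : ∀ n ≤ i, x2 ≠ b n := fun n hn => (hb2 n hn).symm
          have hb3' : ∀ n ≤ i, x3 ≠ b n := fun n hn => (hb3 n hn).symm
          split_ifs at h with h1 h2 h3 h4 h5 h6 h7 h8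
          all_goals first
            | lia
            | exact absurd h h23
            | exact absurd h.symm h23
            | exact absurd h (hb2 _ (by lia))
            | exact absurd h (hb3 _ (by lia))
            | exact absurd h (hb2' _ (by lia))
            | exact absurd h (hb3' _ (by lia))
            | (have := hinj _ (by lia) _ (by lia) h
               lia))
      exact ⟨_, _, p, hp, hl⟩
    · rw [max_eq_right h]
      obtain ⟨p, hp, hl, -⟩ := (G.glue (.pathWith B f N)).graph.exists_isPath_of_adj_succ f N
        (fun n hn => Or.inr ⟨fun h => by simpa using hf h, .inl ⟨n, hn, rfl, rfl⟩⟩)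
        (fun m _ n _ h => hf h)
      exact ⟨_, _, p, hp, hl⟩
  · intro u v p hp
    by_cases huS : u ∈ S
    · have := hp.length_lt_card_of_adj_closed (S := S) (fun a c hac ha =>
        (hadj a c hac).elim And.right fun h => absurd h.1 (hdisj a ha)) huS
      lia
    by_cases huT : u ∈ T
    · have := hp.length_lt_card_of_adj_closed (S := T) (fun a c hac ha =>
        (hadj a c hac).elim (fun h => absurd ha (hdisj a h.1)) And.right) huT
      lia
    cases p with
    | nil => simp
    | cons h p => rcases hadj _ _ h with h | h <;> exact absurd h.1 ‹_›

/-- Long Path does not have finite integer index, even on boundaried graphs in which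
every non-boundary vertex has degree `2`: with boundary `B = {x₁, x₂, x₃}`, the graphs
`G^i` (a path `x₂–b₁–⋯–b_{i+1}–x₃` of length `i+2`, internal vertices distinct and
outside `B`) are pairwise not gluing equivalent with respect to the longest-path
length. -/
theorem stmt16 {V : Type*} [DecidableEq V] [Infinite V]
    (x1 x2 x3 : V) (hB : ({x1, x2, x3} : Finset V).card = 3)
    (i j : ℕ) (hij : i ≠ j)
    (bi bj : ℕ → V)
    (hbi : ∀ n ≤ i, bi n ∉ ({x1, x2, x3} : Finset V))
    (hbj : ∀ n ≤ j, bj n ∉ ({x1, x2, x3} : Finset V))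
    (hbiInj : ∀ m ≤ i, ∀ n ≤ i, bi m = bi n → m = n)
    (hbjInj : ∀ m ≤ j, ∀ n ≤ j, bj m = bj n → m = n)
    (Gi Gj : BGraph V)
    (hvi : Gi.verts = {x1, x2, x3} ∪ (Finset.range (i + 1)).image bi)
    (hvj : Gj.verts = {x1, x2, x3} ∪ (Finset.range (j + 1)).image bj)
    (hGi : ∀ u v, Gi.graph.Adj u v ↔
      u ≠ v ∧ (lpRel x2 x3 bi i u v ∨ lpRel x2 x3 bi i v u))
    (hGj : ∀ u v, Gj.graph.Adj u v ↔
      u ≠ v ∧ (lpRel x2 x3 bj j u v ∨ lpRel x2 x3 bj j v u)) :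
    ¬ ∃ Δ : ℤ, ∀ H : BGraph V, ({x1, x2, x3} : Finset V) ⊆ H.verts →
      H.verts ∩ Gi.verts ⊆ {x1, x2, x3} → H.verts ∩ Gj.verts ⊆ {x1, x2, x3} →
      (lpNumB (Gi.glue H) : ℤ) = lpNumB (Gj.glue H) + Δ := by
  rintro ⟨Δ, hΔ⟩
  have hx23 : x2 ≠ x3 := by
    rintro rfl
    have := Finset.card_le_two (a := x1) (b := x2)
    simp only [Finset.mem_singleton, Finset.insert_eq_of_mem] at hB
    lia
  obtain ⟨f, hf, hfS⟩ : ∃ f : ℕ → V, Function.Injective f ∧ ∀ n, f n ∉ Gi.verts ∪ Gj.verts := by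
    let e := (Gi.verts ∪ Gj.verts).finite_toSet.infinite_compl.natEmbedding
    exact ⟨fun n => e n, fun m n h => e.injective (Subtype.ext h), fun n => by simpa using (e n).2⟩
  have hfi : ∀ n, f n ∉ Gi.verts := fun n h => hfS n (Finset.mem_union_left _ h)
  have hfj : ∀ n, f n ∉ Gj.verts := fun n h => hfS n (Finset.mem_union_right _ h)
  have hinter : ∀ (N : ℕ) (A : Finset V), (∀ n, f n ∉ A) →
      (BGraph.pathWith {x1, x2, x3} f N).verts ∩ A ⊆ {x1, x2, x3} := by
    intro N A hA v hv
    obtain ⟨hv, hvA⟩ := Finset.mem_inter.1 hv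
    rcases Finset.mem_union.1 hv with h | h
    · exact h
    · obtain ⟨n, -, rfl⟩ := Finset.mem_image.1 h
      exact absurd hvA (hA n)
  have key : ∀ N : ℕ, ((max (i + 2) N : ℕ) : ℤ) = (max (j + 2) N : ℕ) + Δ := by
    intro N
    have h := hΔ (.pathWith {x1, x2, x3} f N) Finset.subset_union_left
      (hinter N _ hfi) (hinter N _ hfj)
    rw [lpNumB_glue_pathWith hx23 (fun n hn h => hbi n hn (by simp [h]))
        (fun n hn h => hbi n hn (by simp [h])) hbiInj hGi _ hf
        (fun n h => hfi n (by simp [hvi, h])) (fun n h => hfi n (by simp [hvi, h]))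
        (fun n m hm h => hfi n (by
          rw [hvi, h]
          exact Finset.mem_union_right _ (Finset.mem_image_of_mem _ (by simpa using by lia)))),
      lpNumB_glue_pathWith hx23 (fun n hn h => hbj n hn (by simp [h]))
        (fun n hn h => hbj n hn (by simp [h])) hbjInj hGj _ hf
        (fun n h => hfj n (by simp [hvj, h])) (fun n h => hfj n (by simp [hvj, h]))
        (fun n m hm h => hfj n (by
          rw [hvj, h]
          exact Finset.mem_union_right _ (Finset.mem_image_of_mem _ (by simpa using by lia))))] at h
    exact h
  have h0 := key 0
  have h1 := key (i + j + 4)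
  lia
end

section
/- Let q ≥ 4 be a natural number, let I₀ ⊆ {1, …, q} with |I₀| = ⌊q/2⌋, and let 𝒥 be a family of subsets of {1, …, q}, each of size ⌊q/2⌋. Let F^𝒥 be the graph with vertex set {x_h : h ∈ {1,…,q}} ∪ {y_J : J ∈ 𝒥} ∪ {z_h : h ∈ {1,…,q} \ I₀} (all distinct) whose edges are: {y_J, x_h} whenever h ∈ J, and {z_h, x_h} for each h ∈ {1,…,q} \ I₀. Then: (a) if I₀ ∈ 𝒥, the domination number satisfies γ(F^𝒥) ≤ ⌈q/2⌉ + 1; and (b) if I₀ ∉ 𝒥, then γ(F^𝒥) > ⌈q/2⌉ + 1. -/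
/-- The domination number of `G`: the minimum size of a set `S` of vertices such that
every vertex is in `S` or adjacent to a vertex of `S`. -/
noncomputable def domNum {V : Type*} (G : SimpleGraph V) : ℕ :=
  sInf {n | ∃ S : Finset V, (∀ v : V, v ∈ S ∨ ∃ u ∈ S, G.Adj u v) ∧ S.card = n}

/-- Vertex type of the graph `F^𝒥`: the vertices `x_h` for `h ∈ {1, …, q}`, the
vertices `y_J` for `J ∈ 𝒥`, and the vertices `z_h` for `h ∉ I₀`. -/
abbrev DSV (q : ℕ) (I0 : Finset (Fin q)) (Js : Finset (Finset (Fin q))) : Type :=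
  Fin q ⊕ ({S : Finset (Fin q) // S ∈ Js} ⊕ {h : Fin q // h ∉ I0})

/-- The graph `F^𝒥`: edges `{y_J, x_h}` whenever `h ∈ J`, and edges `{z_h, x_h}` for
each `h ∉ I₀`. -/
def DSgraph (q : ℕ) (I0 : Finset (Fin q)) (Js : Finset (Finset (Fin q))) :
    SimpleGraph (DSV q I0 Js) :=
  SimpleGraph.fromRel (fun u v =>
    (∃ (h : Fin q) (J : {S : Finset (Fin q) // S ∈ Js}),
      h ∈ J.1 ∧ u = Sum.inl h ∧ v = Sum.inr (Sum.inl J)) ∨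
    (∃ h : {h : Fin q // h ∉ I0}, u = Sum.inl h.1 ∧ v = Sum.inr (Sum.inr h)))

theorem domNum_le_card {V : Type*} {G : SimpleGraph V} (S : Finset V)
    (hS : ∀ v : V, v ∈ S ∨ ∃ u ∈ S, G.Adj u v) : domNum G ≤ S.card :=
  Nat.sInf_le ⟨S, hS, rfl⟩

theorem exists_card_eq_domNum {V : Type*} [Fintype V] (G : SimpleGraph V) :
    ∃ S : Finset V, (∀ v : V, v ∈ S ∨ ∃ u ∈ S, G.Adj u v) ∧ S.card = domNum G :=
  Nat.sInf_mem
    (s := {n | ∃ S : Finset V, (∀ v : V, v ∈ S ∨ ∃ u ∈ S, G.Adj u v) ∧ S.card = n})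
    ⟨_, Finset.univ, fun v => Or.inl (Finset.mem_univ v), rfl⟩

section Adjacency

variable {q : ℕ} {I0 : Finset (Fin q)} {Js : Finset (Finset (Fin q))}

theorem DSgraph_adj_y_iff (u : DSV q I0 Js) (J : {S : Finset (Fin q) // S ∈ Js}) :
    (DSgraph q I0 Js).Adj u (Sum.inr (Sum.inl J)) ↔ ∃ h ∈ J.1, u = Sum.inl h := by
  rcases u with h | J' | z <;> simp [DSgraph]

theorem DSgraph_adj_z_iff (u : DSV q I0 Js) (z : {h : Fin q // h ∉ I0}) :
    (DSgraph q I0 Js).Adj u (Sum.inr (Sum.inr z)) ↔ u = Sum.inl z.1 := by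
  rcases u with h | J' | z' <;> simp [DSgraph]
  grind

theorem DSgraph_adj_x_iff (u : DSV q I0 Js) (h : Fin q) :
    (DSgraph q I0 Js).Adj u (Sum.inl h) ↔
      (∃ J : {S : Finset (Fin q) // S ∈ Js}, h ∈ J.1 ∧ u = Sum.inr (Sum.inl J)) ∨
      ∃ z : {h : Fin q // h ∉ I0}, z.1 = h ∧ u = Sum.inr (Sum.inr z) := by
  rcases u with h' | J' | z' <;> simp [DSgraph]
  all_goals grind

end Adjacency

theorem domNum_DSgraph_le {q : ℕ} {I0 : Finset (Fin q)} {Js : Finset (Finset (Fin q))}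
    (hJs : ∀ J ∈ Js, J.card = I0.card) (hI : I0 ∈ Js) :
    domNum (DSgraph q I0 Js) ≤ I0ᶜ.card + 1 := by
  classical
  let y : DSV q I0 Js := Sum.inr (Sum.inl ⟨I0, hI⟩)
  refine (domNum_le_card (insert y (I0ᶜ.image Sum.inl)) ?_).trans
    ((Finset.card_insert_le _ _).trans (Nat.add_le_add_right Finset.card_image_le 1))
  rintro (h | J | z)
  · by_cases hh : h ∈ I0
    · exact Or.inr ⟨y, by simp, (DSgraph_adj_x_iff _ _).2 (Or.inl ⟨_, hh, rfl⟩)⟩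
    · exact Or.inl (by simp [hh])
  · by_cases hJ : J.1 ⊆ I0
    · have hEq : J = ⟨I0, hI⟩ :=
        Subtype.ext (Finset.eq_of_subset_of_card_le hJ (hJs J.1 J.2).ge)
      exact Or.inl (by simp [hEq, y])
    · obtain ⟨h, hhJ, hh⟩ := Finset.not_subset.1 hJ
      exact Or.inr ⟨Sum.inl h, by simp [hh], (DSgraph_adj_y_iff _ _).2 ⟨h, hhJ, rfl⟩⟩
  · exact Or.inr ⟨Sum.inl z.1, by simp [z.2], (DSgraph_adj_z_iff _ _).2 rfl⟩

theorem lt_domNum_DSgraph {q : ℕ} {I0 : Finset (Fin q)} {Js : Finset (Finset (Fin q))}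
    (hI0 : 2 ≤ I0.card) (hJs : ∀ J ∈ Js, J.card = I0.card) (hI : I0 ∉ Js) :
    I0ᶜ.card + 1 < domNum (DSgraph q I0 Js) := by
  classical
  obtain ⟨S, hS, hcard⟩ := exists_card_eq_domNum (DSgraph q I0 Js)
  rw [← hcard]
  by_contra! hle
  have hz : ∀ z : {h : Fin q // h ∉ I0}, ∃ v ∈ S, v = Sum.inl z.1 ∨ v = Sum.inr (Sum.inr z) := by
    intro z
    rcases hS (Sum.inr (Sum.inr z)) with h | ⟨u, hu, ha⟩
    · exact ⟨_, h, Or.inr rfl⟩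
    · exact ⟨u, hu, Or.inl ((DSgraph_adj_z_iff _ _).1 ha)⟩
  choose g hgS hg using hz
  have hinj : Function.Injective g := by
    intro a b hab
    rcases hg a with ha | ha <;> rcases hg b with hb | hb <;>
      rw [ha, hb] at hab <;> simp_all [Subtype.ext_iff]
  let T := Finset.univ.image g
  have hTcard : T.card = I0ᶜ.card := by
    rw [Finset.card_image_of_injective _ hinj, Finset.card_univ, Fintype.card_subtype_compl,
      Finset.card_compl, Fintype.card_coe]
  have hTS : T ⊆ S := by
    intro v hv
    obtain ⟨z, -, rfl⟩ := Finset.mem_image.1 hv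
    exact hgS z
  have hone : (S \ T).card ≤ 1 := by
    rw [Finset.card_sdiff_of_subset hTS]; omega
  have hyT : ∀ J, Sum.inr (Sum.inl J) ∉ T := by
    intro J hJ
    obtain ⟨z, -, hz⟩ := Finset.mem_image.1 hJ
    rcases hg z with h | h <;> simp [h] at hz
  have hxT : ∀ h ∈ I0, Sum.inl h ∉ T := by
    intro h hh hT
    obtain ⟨z, -, hz⟩ := Finset.mem_image.1 hT
    rcases hg z with h' | h' <;> simp [h'] at hz
    exact z.2 (hz ▸ hh)
  have hdom : ∀ h ∈ I0, ∃ v ∈ S \ T, v = Sum.inl h ∨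
      ∃ J : {S : Finset (Fin q) // S ∈ Js}, h ∈ J.1 ∧ v = Sum.inr (Sum.inl J) := by
    intro h hh
    rcases hS (Sum.inl h) with hx | ⟨u, hu, ha⟩
    · exact ⟨_, Finset.mem_sdiff.2 ⟨hx, hxT h hh⟩, Or.inl rfl⟩
    · rcases (DSgraph_adj_x_iff _ _).1 ha with ⟨J, hJ, rfl⟩ | ⟨z, rfl, -⟩
      · exact ⟨_, Finset.mem_sdiff.2 ⟨hu, hyT J⟩, Or.inr ⟨J, hJ, rfl⟩⟩
      · exact absurd hh z.2
  obtain ⟨a, ha, b, hb, hab⟩ := Finset.one_lt_card.1 hI0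
  obtain ⟨v, hv, hva⟩ := hdom a ha
  have hall : ∀ h ∈ I0, v = Sum.inl h ∨
      ∃ J : {S : Finset (Fin q) // S ∈ Js}, h ∈ J.1 ∧ v = Sum.inr (Sum.inl J) := by
    intro h hh
    obtain ⟨w, hw, hwh⟩ := hdom h hh
    rwa [Finset.card_le_one.1 hone v hv w hw]
  rcases hva with rfl | ⟨J, -, rfl⟩
  · have := hall b hb
    simp [hab] at this
  · have hsub : I0 ⊆ J.1 := by
      intro h hh
      rcases hall h hh with h' | ⟨J', hJ', h'⟩
      · simp at h'
      · simp only [Sum.inr.injEq, Sum.inl.injEq] at h'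
        exact h' ▸ hJ'
    exact hI (Finset.eq_of_subset_of_card_le hsub (hJs J.1 J.2).le ▸ J.2)

/-- For `q ≥ 4`, `I₀` of size `⌊q/2⌋`, and a family `𝒥` of size-`⌊q/2⌋` subsets of
`{1, …, q}`: if `I₀ ∈ 𝒥` then `γ(F^𝒥) ≤ ⌈q/2⌉ + 1`, and if `I₀ ∉ 𝒥` then
`γ(F^𝒥) > ⌈q/2⌉ + 1`. -/
theorem stmt17 (q : ℕ) (hq : 4 ≤ q) (I0 : Finset (Fin q)) (hI0 : I0.card = q / 2)
    (Js : Finset (Finset (Fin q))) (hJs : ∀ J ∈ Js, J.card = q / 2) :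
    (I0 ∈ Js → domNum (DSgraph q I0 Js) ≤ (q + 1) / 2 + 1) ∧
    (I0 ∉ Js → (q + 1) / 2 + 1 < domNum (DSgraph q I0 Js)) := by
  have hJs' : ∀ J ∈ Js, J.card = I0.card := fun J hJ => (hJs J hJ).trans hI0.symm
  have hc : I0ᶜ.card = (q + 1) / 2 := by
    rw [Finset.card_compl, Fintype.card_fin]; omega
  rw [← hc]
  exact ⟨domNum_DSgraph_le hJs', lt_domNum_DSgraph (by omega) hJs'⟩
end

section
/- For every natural number q ≥ 4 there exists a family of 2^(C(q, ⌊q/2⌋)) boundaried graphs (where C(q, ⌊q/2⌋) is the binomial coefficient), each having boundary B of size q and each with all non-boundary vertices forming an independent set, that are pairwise not gluing equivalent with respect to the domination number: for any two distinct members G_B and G'_B of the family there is no integer Δ such that γ(G_B ⊕ H_B) = γ(G'_B ⊕ H_B) + Δ for every boundaried graph H_B with V(H) ∩ V(G) ⊆ B and V(H) ∩ V(G') ⊆ B. In particular, Dominating Set does not have single-exponential integer index, even on boundaried graphs with G − B an independent set. -/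
/-- The domination number of a boundaried graph: the minimum size of a set `S` of its
vertices such that every vertex of the graph is in `S` or adjacent to a vertex
of `S`. -/
noncomputable def domNumB {V : Type*} (A : BGraph V) : ℕ :=
  sInf {n | ∃ S : Finset V, S ⊆ A.verts ∧
    (∀ v ∈ A.verts, v ∈ S ∨ ∃ u ∈ S, A.graph.Adj u v) ∧ S.card = n}

open Finset in
/-- If a dominating set is indexed by `D` and there are vertices indexed by `D` with pairwise
disjoint closed neighbourhoods, then the domination number is the cardinality of `D`. -/
theorem domNumB_eq_card {V ι : Type*} [DecidableEq V] (A : BGraph V) (D : Finset ι) (d f : ι → V)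
    (hd : ∀ i ∈ D, d i ∈ A.verts)
    (hdom : ∀ v ∈ A.verts, ∃ i ∈ D, d i = v ∨ A.graph.Adj (d i) v)
    (hf : ∀ i ∈ D, f i ∈ A.verts)
    (hpack : ∀ i ∈ D, ∀ j ∈ D, ∀ u, (u = f i ∨ A.graph.Adj u (f i)) →
      (u = f j ∨ A.graph.Adj u (f j)) → i = j) :
    domNumB A = D.card := by
  have lower : ∀ S : Finset V, (∀ v ∈ A.verts, v ∈ S ∨ ∃ u ∈ S, A.graph.Adj u v) →
      D.card ≤ S.card := by
    intro S hS
    refine card_le_card_of_forall_subsingleton (fun i u => u = f i ∨ A.graph.Adj u (f i)) ?_ ?_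
    · intro i hi
      rcases hS _ (hf i hi) with h | ⟨u, hu, h⟩
      · exact ⟨_, h, Or.inl rfl⟩
      · exact ⟨u, hu, Or.inr h⟩
    · rintro u - i ⟨hi, hiu⟩ j ⟨hj, hju⟩
      exact hpack i hi j hj u hiu hju
  have hdomS : ∀ v ∈ A.verts, v ∈ D.image d ∨ ∃ u ∈ D.image d, A.graph.Adj u v := by
    intro v hv
    obtain ⟨i, hi, rfl | h⟩ := hdom v hv
    · exact Or.inl (mem_image_of_mem d hi)
    · exact Or.inr ⟨_, mem_image_of_mem d hi, h⟩
  have hmem : D.card ∈ {n | ∃ S : Finset V, S ⊆ A.verts ∧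
      (∀ v ∈ A.verts, v ∈ S ∨ ∃ u ∈ S, A.graph.Adj u v) ∧ S.card = n} :=
    ⟨D.image d, image_subset_iff.2 hd, hdomS, le_antisymm card_image_le (lower _ hdomS)⟩
  refine le_antisymm (Nat.sInf_le hmem) (le_csInf ⟨_, hmem⟩ ?_)
  rintro n ⟨S, -, hS, rfl⟩
  exact lower S hS

/-- The image of a graph under an embedding of the ambient vertex types. -/
def BGraph.map {T V : Type*} (e : T ↪ V) (A : BGraph T) : BGraph V where
  verts := A.verts.map e
  graph := A.graph.map e
  support := by
    rintro u v h
    obtain ⟨a, b, hab, rfl, rfl⟩ := (SimpleGraph.map_adj e A.graph _ _).1 h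
    simpa using A.support hab

theorem BGraph.map_glue {T V : Type*} [DecidableEq T] [DecidableEq V] (e : T ↪ V)
    (A H : BGraph T) : (A.map e).glue (H.map e) = (A.glue H).map e := by
  simp only [BGraph.glue, BGraph.map, BGraph.mk.injEq, Finset.map_union, true_and]
  ext u v
  simp only [SimpleGraph.sup_adj, SimpleGraph.map_adj]
  grind

theorem domNumB_map {T V : Type*} (e : T ↪ V) (A : BGraph T) :
    domNumB (A.map e) = domNumB A := by
  unfold domNumB
  congr 1
  ext n
  constructor
  · rintro ⟨S, hS, hdom, rfl⟩
    obtain ⟨S, hS', rfl⟩ := Finset.subset_map_iff.1 hS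
    refine ⟨S, hS', fun v hv => ?_, by simp⟩
    simpa [BGraph.map] using hdom (e v) (by simpa [BGraph.map] using hv)
  · rintro ⟨S, hS, hdom, rfl⟩
    refine ⟨S.map e, Finset.map_subset_map.2 hS, fun v hv => ?_, by simp⟩
    obtain ⟨w, hw, rfl⟩ := Finset.mem_map.1 hv
    simpa [BGraph.map] using hdom w hw

/-- A clique on `Fin q` together with, for every `S ∈ 𝒜`, a new vertex with neighbourhood `S`. -/
def hypergraphGadget {q : ℕ} (𝒜 : Finset (Finset (Fin q))) :
    BGraph (Fin q ⊕ Fin q ⊕ Finset (Fin q)) where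
  verts := Finset.univ.disjSum ((∅ : Finset (Fin q)).disjSum 𝒜)
  graph :=
    { Adj := fun
        | .inl i, .inl j => i ≠ j
        | .inl i, .inr (.inr S) => i ∈ S ∧ S ∈ 𝒜
        | .inr (.inr S), .inl i => i ∈ S ∧ S ∈ 𝒜
        | _, _ => False
      symm := ⟨by rintro (i | i | S) (j | j | S') <;> simp [eq_comm]⟩
      loopless := ⟨by rintro (i | i | S) <;> simp⟩ }
  support := by rintro (i | i | S) (j | j | S') <;> simp

/-- The graph on `Fin q` with no edges, with a pendant vertex attached to every element of `X`. -/
def pendantGadget {q : ℕ} (X : Finset (Fin q)) :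
    BGraph (Fin q ⊕ Fin q ⊕ Finset (Fin q)) where
  verts := Finset.univ.disjSum (X.disjSum ∅)
  graph :=
    { Adj := fun
        | .inl i, .inr (.inl j) => i = j ∧ j ∈ X
        | .inr (.inl j), .inl i => i = j ∧ j ∈ X
        | _, _ => False
      symm := ⟨by rintro (i | i | S) (j | j | S') <;> simp⟩
      loopless := ⟨by rintro (i | i | S) <;> simp⟩ }
  support := by rintro (i | i | S) (j | j | S') <;> simp

/-- Attaching pendants to `X` forces `X` into a dominating set, leaving only the vertices of the
sets of `𝒜` disjoint from `X` undominated. -/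
theorem domNumB_hypergraphGadget_glue {q : ℕ} (𝒜 : Finset (Finset (Fin q))) (X : Finset (Fin q))
    (hX : X.Nonempty)
    (huniq : ∀ S ∈ 𝒜, ∀ S' ∈ 𝒜, Disjoint S X → Disjoint S' X → S = S') :
    domNumB ((hypergraphGadget 𝒜).glue (pendantGadget X)) =
      X.card + (𝒜.filter (Disjoint · X)).card := by
  obtain ⟨x, hx⟩ := hX
  rw [← Finset.card_disjSum]
  refine domNumB_eq_card _ _
    (Sum.elim Sum.inl fun S => Sum.inr (Sum.inr S)) Sum.inr ?_ ?_ ?_ ?_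
  · rintro (i | S) <;> simp +contextual [BGraph.glue, hypergraphGadget, pendantGadget]
  · rintro (i | i | S) hv
    · refine ⟨Sum.inl x, by simpa using hx, ?_⟩
      simpa [BGraph.glue, hypergraphGadget, pendantGadget] using em (x = i)
    · refine ⟨Sum.inl i, ?_⟩
      simpa [BGraph.glue, hypergraphGadget, pendantGadget] using hv
    · have hS : S ∈ 𝒜 := by simpa [BGraph.glue, hypergraphGadget, pendantGadget] using hv
      by_cases h : Disjoint S X
      · exact ⟨Sum.inr S, by simp [hS, h], Or.inl rfl⟩
      · obtain ⟨i, hi, hiX⟩ := Finset.not_disjoint_iff.1 h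
        exact ⟨Sum.inl i, by simpa using hiX, Or.inr (Or.inl ⟨hi, hS⟩)⟩
  · rintro (i | S) <;> simp +contextual [BGraph.glue, hypergraphGadget, pendantGadget]
  · have hdisj := fun S : Finset (Fin q) => Finset.disjoint_left (s := S) (t := X)
    rintro (i | S) hi (j | S') hj (u | u | U) <;>
      simp [BGraph.glue, hypergraphGadget, pendantGadget] at hi hj ⊢ <;> grind

/-- Dominating Set does not have single-exponential integer index, even on boundaried
graphs whose non-boundary part is an independent set: for every `q ≥ 4` there are
`2 ^ (q choose ⌊q/2⌋)` boundaried graphs, each with boundary `B` of size `q` and all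
edges incident to `B`, that are pairwise not gluing equivalent with respect to the
domination number. -/
theorem stmt18 {V : Type*} [DecidableEq V] [Infinite V] (q : ℕ) (hq : 4 ≤ q) :
    ∃ (B : Finset V) (F : Fin (2 ^ q.choose (q / 2)) → BGraph V),
      B.card = q ∧
      (∀ k, B ⊆ (F k).verts) ∧
      (∀ k, ∀ u v : V, (F k).graph.Adj u v → u ∈ B ∨ v ∈ B) ∧
      (∀ k l, k ≠ l →
        ¬ ∃ Δ : ℤ, ∀ H : BGraph V, B ⊆ H.verts →
          H.verts ∩ (F k).verts ⊆ B → H.verts ∩ (F l).verts ⊆ B →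
          (domNumB ((F k).glue H) : ℤ) = domNumB ((F l).glue H) + Δ) := by
  obtain ⟨c, hc⟩ := exists_injective_nat (Fin q ⊕ Fin q ⊕ Finset (Fin q))
  let e : (Fin q ⊕ Fin q ⊕ Finset (Fin q)) ↪ V :=
    (⟨c, hc⟩ : _ ↪ ℕ).trans (Infinite.natEmbedding V)
  let L : Finset (Finset (Fin q)) := Finset.univ.powersetCard (q / 2)
  have hL : L.powerset.card = 2 ^ q.choose (q / 2) := by simp [L]
  let E := (Finset.equivFinOfCardEq hL).symm
  let B : Finset V := Finset.univ.map (Function.Embedding.inl.trans e)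
  have hBmem : ∀ i, e (Sum.inl i) ∈ B := fun i =>
    Finset.mem_map_of_mem (Function.Embedding.inl.trans e) (Finset.mem_univ i)
  have hBH : ∀ X, B ⊆ ((pendantGadget X).map e).verts := by
    intro X v hv
    obtain ⟨i, -, rfl⟩ := Finset.mem_map.1 hv
    simp [BGraph.map, pendantGadget]
  have hinter : ∀ X 𝒜, ((pendantGadget X).map e).verts ∩
      ((hypergraphGadget 𝒜).map e).verts ⊆ B := by
    intro X 𝒜
    simp only [BGraph.map, ← Finset.map_inter]
    intro v hv
    obtain ⟨i | i | S, hi, rfl⟩ := Finset.mem_map.1 hv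
    · exact hBmem i
    · simp [pendantGadget, hypergraphGadget] at hi
    · simp [pendantGadget, hypergraphGadget] at hi
  refine ⟨B, fun k => (hypergraphGadget (E k : Finset (Finset (Fin q)))).map e,
    by simp [B], ?_, ?_, ?_⟩
  · intro k v hv
    obtain ⟨i, -, rfl⟩ := Finset.mem_map.1 hv
    simp [BGraph.map, hypergraphGadget]
  · intro k u v h
    obtain ⟨a, b, hab, rfl, rfl⟩ := (SimpleGraph.map_adj e _ _ _).1 h
    rcases a with i | i | S
    · exact Or.inl (hBmem i)
    · exact absurd hab (by simp [hypergraphGadget])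
    · rcases b with j | j | S'
      · exact Or.inr (hBmem j)
      · exact absurd hab (by simp [hypergraphGadget])
      · exact absurd hab (by simp [hypergraphGadget])
  · rintro k l hkl ⟨Δ, hΔ⟩
    have hcard : ∀ k, ∀ S ∈ (E k : Finset (Finset (Fin q))), S.card = q / 2 := fun k S hS =>
      (Finset.mem_powersetCard.1 (Finset.mem_powerset.1 (E k).2 hS)).2
    have key := fun X => hΔ ((pendantGadget X).map e) (hBH X) (hinter X _) (hinter X _)
    simp only [BGraph.map_glue, domNumB_map] at key
    have hfull : ∀ k, domNumB ((hypergraphGadget (E k : Finset (Finset (Fin q)))).glue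
        (pendantGadget Finset.univ)) = q := by
      intro k
      have hne : ∀ S ∈ (E k : Finset (Finset (Fin q))), ¬ Disjoint S Finset.univ := by
        intro S hS h
        have := hcard k S hS
        rw [disjoint_top.1 h, Finset.bot_eq_empty, Finset.card_empty] at this
        omega
      rw [domNumB_hypergraphGadget_glue _ _ ⟨⟨0, by omega⟩, Finset.mem_univ _⟩
        fun S hS _ _ h => absurd h (hne S hS), Finset.filter_false_of_mem hne]
      simp
    have hΔ0 : Δ = 0 := by
      have := key Finset.univ
      rw [hfull, hfull] at this
      omega
    have hcompl : ∀ S₀ : Finset (Fin q), S₀.card = q / 2 → ∀ k,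
        domNumB ((hypergraphGadget (E k : Finset (Finset (Fin q)))).glue (pendantGadget S₀ᶜ)) =
          S₀ᶜ.card + if S₀ ∈ (E k : Finset (Finset (Fin q))) then 1 else 0 := by
      intro S₀ hS₀ k
      have hiff : ∀ S ∈ (E k : Finset (Finset (Fin q))), (Disjoint S S₀ᶜ ↔ S = S₀) := by
        intro S hS
        rw [disjoint_compl_right_iff]
        refine ⟨fun h => Finset.eq_of_subset_of_card_le h ?_, fun h => h.le⟩
        rw [hS₀, hcard k S hS]
      rw [domNumB_hypergraphGadget_glue, Finset.filter_congr hiff, Finset.filter_eq']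
      · split_ifs <;> simp
      · rw [← Finset.card_pos, Finset.card_compl, Fintype.card_fin]
        omega
      · intro S hS S' hS' h h'
        rw [(hiff S hS).1 h, (hiff S' hS').1 h']
    refine hkl (E.injective (Subtype.ext (Finset.ext fun S₀ => ?_)))
    by_cases hS₀ : S₀.card = q / 2
    · have := key S₀ᶜ
      rw [hcompl S₀ hS₀, hcompl S₀ hS₀, hΔ0] at this
      split_ifs at this <;> simp_all
    · exact ⟨fun h => absurd (hcard k _ h) hS₀, fun h => absurd (hcard l _ h) hS₀⟩
end
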